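/- Strong Δ-equivalence is transitive for operator algebras with contractive approximate identities: Let A ⊆ B(H_A), B ⊆ B(H_B), C ⊆ B(H_C) be norm-closed subalgebras acting nondegenerately, each possessing a contractive approximate identity. Suppose there exist completely isometric nondegenerate representations α₁ of A and β₁ of B such that α₁(A) and β₁(B) are strongly TRO equivalent, and completely isometric nondegenerate representations β₂ of B and γ₂ of C such that β₂(B) and γ₂(C) are strongly TRO equivalent. Then there exist completely isometric nondegenerate representations α of A and γ of C such that α(A) and γ(C) are strongly TRO equivalent. -/

import Mathlib

noncomputable section

open ContinuousLinearMap

/-- The norm-closed linear span of a set of operators. -/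
def clspan {V : Type*} [NormedAddCommGroup V] [NormedSpace ℂ V] (S : Set V) : Set V :=
  closure (Submodule.span ℂ S : Set V)

/-- A set is a norm-closed linear subspace. -/
def IsClosedSubspace {V : Type*} [NormedAddCommGroup V] [NormedSpace ℂ V] (S : Set V) : Prop :=
  IsClosed S ∧ ∃ p : Submodule ℂ V, (p : Set V) = S

variable {H K L R : Type*}
  [NormedAddCommGroup H] [InnerProductSpace ℂ H] [CompleteSpace H]
  [NormedAddCommGroup K] [InnerProductSpace ℂ K] [CompleteSpace K]
  [NormedAddCommGroup L] [InnerProductSpace ℂ L] [CompleteSpace L]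
  [NormedAddCommGroup R] [InnerProductSpace ℂ R] [CompleteSpace R]

/-- A ternary ring of operators: a norm-closed subspace `M ⊆ B(H,K)` with `M M* M ⊆ M`. -/
def IsTRO (M : Set (H →L[ℂ] K)) : Prop :=
  IsClosedSubspace M ∧
    ∀ m₁ ∈ M, ∀ m₂ ∈ M, ∀ m₃ ∈ M, m₁ ∘L ((adjoint m₂) ∘L m₃) ∈ M

/-- A norm-closed subalgebra of `B(H)`. -/
def IsClosedSubalgebra (A : Set (H →L[ℂ] H)) : Prop :=
  IsClosedSubspace A ∧ ∀ a ∈ A, ∀ b ∈ A, a * b ∈ A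

/-- `[M* B M]`, the norm-closed linear span of `{m₁* b m₂ : m₁, m₂ ∈ M, b ∈ B}`. -/
def conjTRO (M : Set (H →L[ℂ] K)) (B : Set (K →L[ℂ] K)) : Set (H →L[ℂ] H) :=
  clspan {x | ∃ m₁ ∈ M, ∃ m₂ ∈ M, ∃ b ∈ B, x = (adjoint m₁) ∘L (b ∘L m₂)}

/-- `[M A M*]`, the norm-closed linear span of `{m₁ a m₂* : m₁, m₂ ∈ M, a ∈ A}`. -/
def conjTRO' (M : Set (H →L[ℂ] K)) (A : Set (H →L[ℂ] H)) : Set (K →L[ℂ] K) :=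
  clspan {x | ∃ m₁ ∈ M, ∃ m₂ ∈ M, ∃ a ∈ A, x = m₁ ∘L (a ∘L (adjoint m₂))}

/-- An algebra `A ⊆ B(H)` acts nondegenerately: the span of `A(H)` is dense in `H`. -/
def Nondegenerate (A : Set (H →L[ℂ] H)) : Prop :=
  Dense (Submodule.span ℂ {v : H | ∃ a ∈ A, ∃ h : H, v = a h} : Set H)

/-- A contractive approximate identity for `A`: a net `(e t)` in the unit ball of `A`
with `‖e t * a - a‖ → 0` and `‖a * e t - a‖ → 0` for every `a ∈ A`. -/
def HasCai (A : Set (H →L[ℂ] H)) : Prop :=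
  ∃ (ι : Type) (_ : Preorder ι) (_ : IsDirected ι (· ≤ ·)) (_ : Nonempty ι)
    (e : ι → (H →L[ℂ] H)),
    (∀ t, e t ∈ A) ∧ (∀ t, ‖e t‖ ≤ 1) ∧
    ∀ a ∈ A, Filter.Tendsto (fun t => ‖e t * a - a‖) Filter.atTop (nhds 0) ∧
      Filter.Tendsto (fun t => ‖a * e t - a‖) Filter.atTop (nhds 0)

/-- A countable approximate identity for `A`: a sequence `(e n)` in `A` with
`‖e n * a - a‖ → 0` and `‖a * e n - a‖ → 0` for every `a ∈ A`. -/
def HasCountableAI (A : Set (H →L[ℂ] H)) : Prop :=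
  ∃ e : ℕ → (H →L[ℂ] H), (∀ n, e n ∈ A) ∧
    ∀ a ∈ A, Filter.Tendsto (fun n => ‖e n * a - a‖) Filter.atTop (nhds 0) ∧
      Filter.Tendsto (fun n => ‖a * e n - a‖) Filter.atTop (nhds 0)

/-- The operator on the ℓ²-direct sum `R^n` associated to an `n × n` matrix of operators. -/
def matrixOp {n : ℕ} (x : Fin n → Fin n → (R →L[ℂ] R)) :
    (PiLp 2 fun _ : Fin n => R) →L[ℂ] (PiLp 2 fun _ : Fin n => R) :=
  ((PiLp.continuousLinearEquiv 2 ℂ (fun _ : Fin n => R)).symm.toContinuousLinearMap.comp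
      (ContinuousLinearMap.pi fun i =>
        ∑ j, (x i j).comp (ContinuousLinearMap.proj j))).comp
    (PiLp.continuousLinearEquiv 2 ℂ (fun _ : Fin n => R)).toContinuousLinearMap

/-- `φ` is completely isometric on a subspace `A ⊆ B(R)`: every matrix amplification of `φ`
preserves the operator matrix norms. -/
def CompletelyIsometricOn (A : Set (R →L[ℂ] R)) (φ : (R →L[ℂ] R) → (H →L[ℂ] H)) : Prop :=
  ∀ (n : ℕ) (x : Fin n → Fin n → (R →L[ℂ] R)), (∀ i j, x i j ∈ A) →
    ‖matrixOp (fun i j => φ (x i j))‖ = ‖matrixOp x‖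

/-- `α` is a completely isometric nondegenerate representation of the operator algebra
`A ⊆ B(R)` on the Hilbert space `H`: it is linear and multiplicative on `A`,
completely isometric on `A`, and the span of `α(A)H` is dense in `H`. -/
def IsCIRepOn (A : Set (R →L[ℂ] R)) (α : (R →L[ℂ] R) → (H →L[ℂ] H)) : Prop :=
  (∀ a ∈ A, ∀ b ∈ A, α (a + b) = α a + α b) ∧
  (∀ (c : ℂ), ∀ a ∈ A, α (c • a) = c • α a) ∧
  (∀ a ∈ A, ∀ b ∈ A, α (a * b) = α a * α b) ∧
  CompletelyIsometricOn A α ∧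
  Dense (Submodule.span ℂ {v : H | ∃ a ∈ A, ∃ h : H, v = α a h} : Set H)

/-- Two concretely represented operator algebras are strongly TRO equivalent. -/
def StronglyTROEquivalent (X : Set (H →L[ℂ] H)) (Y : Set (K →L[ℂ] K)) : Prop :=
  ∃ M : Set (H →L[ℂ] K), IsTRO M ∧ X = conjTRO M Y ∧ Y = conjTRO' M X

/-- Two operator algebras are strongly Δ-equivalent: they admit completely isometric
nondegenerate representations with strongly TRO equivalent ranges. -/
def StronglyDeltaEquivalent (A : Set (H →L[ℂ] H)) (B : Set (K →L[ℂ] K)) : Prop :=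
  ∃ (H' K' : Type) (_ : NormedAddCommGroup H') (_ : InnerProductSpace ℂ H')
    (_ : CompleteSpace H') (_ : NormedAddCommGroup K') (_ : InnerProductSpace ℂ K')
    (_ : CompleteSpace K')
    (α : (H →L[ℂ] H) → (H' →L[ℂ] H')) (β : (K →L[ℂ] K) → (K' →L[ℂ] K')),
    IsCIRepOn A α ∧ IsCIRepOn B β ∧ StronglyTROEquivalent (α '' A) (β '' B)

/-- The Hilbert space `ℓ²(H)` of square-summable sequences in `H`. -/
abbrev l2 (H : Type*) [NormedAddCommGroup H] [InnerProductSpace ℂ H] : Type _ :=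
  lp (fun _ : ℕ => H) 2

/-- The isometric embedding `S_i` of `H` onto the `i`-th coordinate of `ℓ²(H)`. -/
def lpSingle (i : ℕ) : H →L[ℂ] l2 H :=
  LinearMap.mkContinuous
    { toFun := fun a => lp.single 2 i a
      map_add' := fun a b => by
        apply lp.ext
        funext j
        by_cases h : j = i
        · subst h; simp [lp.single_apply_self]
        · simp [lp.single_apply_ne _ _ _ h, lp.coeFn_add]
      map_smul' := fun c a => by simp }
    1 (fun a => by
      simpa using (lp.norm_single (p := 2) (by norm_num) (fun _ : ℕ => a) i).le)

/-- The stabilization `K_∞(A) = [{S_i a S_j* : a ∈ A, i, j ∈ ℕ}] ⊆ B(ℓ²(H))`. -/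
def Kinf (A : Set (H →L[ℂ] H)) : Set (l2 H →L[ℂ] l2 H) :=
  clspan {x | ∃ a ∈ A, ∃ i j : ℕ, x = (lpSingle i) ∘L (a ∘L (adjoint (lpSingle j)))}


set_option linter.all false
set_option linter.deprecated false
section aux
open Filter Topology

variable {K1 K2 H1 H2 L2 : Type}
  [NormedAddCommGroup K1] [InnerProductSpace ℂ K1] [CompleteSpace K1]
  [NormedAddCommGroup K2] [InnerProductSpace ℂ K2] [CompleteSpace K2]
  [NormedAddCommGroup H1] [InnerProductSpace ℂ H1] [CompleteSpace H1]
  [NormedAddCommGroup H2] [InnerProductSpace ℂ H2] [CompleteSpace H2]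
  [NormedAddCommGroup L2] [InnerProductSpace ℂ L2] [CompleteSpace L2]

theorem matrixOp_apply {R : Type*} [NormedAddCommGroup R] [InnerProductSpace ℂ R] [CompleteSpace R]
    {n : ℕ} (x : Fin n → Fin n → (R →L[ℂ] R))
    (v : PiLp 2 fun _ : Fin n => R) (i : Fin n) : matrixOp x v i = ∑ j, x i j (v j) := by
  simp [matrixOp, _root_.sum_apply]

theorem matrixOp_one_sub {R : Type*} [NormedAddCommGroup R] [InnerProductSpace ℂ R] [CompleteSpace R]
    {n : ℕ} (x : Fin n → Fin n → (R →L[ℂ] R)) (s : ℂ) :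
    matrixOp (fun i j => (if i = j then 1 else 0) - s • x i j) = 1 - s • matrixOp x := by
  ext v i
  simp only [matrixOp_apply, ContinuousLinearMap.sub_apply, PiLp.sub_apply, Finset.sum_sub_distrib,
    ContinuousLinearMap.smul_apply, PiLp.smul_apply, Finset.smul_sum]
  congr 1
  rw [Finset.sum_eq_single i] <;> simp +contextual [eq_comm]

theorem matrixOp_inner {R : Type*} [NormedAddCommGroup R] [InnerProductSpace ℂ R] [CompleteSpace R]
    {n : ℕ} (x : Fin n → Fin n → (R →L[ℂ] R)) (u v : PiLp 2 fun _ : Fin n => R) :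
    inner ℂ u (matrixOp x v) = ∑ i, ∑ j, inner ℂ (u i) (x i j (v j)) := by
  simp [PiLp.inner_apply, matrixOp_apply, inner_sum]

theorem norm_matrixOp_fin1 {R : Type*} [NormedAddCommGroup R] [InnerProductSpace ℂ R] [CompleteSpace R]
    (x : R →L[ℂ] R) : ‖matrixOp (fun _ _ : Fin 1 => x)‖ = ‖x‖ := by
  have hn : ∀ v : PiLp 2 fun _ : Fin 1 => R, ‖v‖ = ‖v 0‖ := fun v => by
    simp [PiLp.norm_eq_of_L2]
  apply le_antisymm
  · refine ContinuousLinearMap.opNorm_le_bound _ (norm_nonneg _) fun v => ?_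
    rw [hn, hn, matrixOp_apply]
    simpa using x.le_opNorm (v 0)
  · refine ContinuousLinearMap.opNorm_le_bound _ (norm_nonneg _) fun v => ?_
    have := (matrixOp (fun _ _ : Fin 1 => x)).le_opNorm (WithLp.toLp 2 fun _ => v)
    rw [hn, hn, matrixOp_apply] at this
    simpa using this

theorem norm_matrixOp_mul_le {n : ℕ} (x : Fin n → Fin n → (K1 →L[ℂ] K1)) (e : K1 →L[ℂ] K1)
    (he : ‖e‖ ≤ 1) : ‖matrixOp (fun i j => x i j * e)‖ ≤ ‖matrixOp x‖ := by
  refine ContinuousLinearMap.opNorm_le_bound _ (norm_nonneg _) fun v => ?_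
  have h1 : matrixOp (fun i j => x i j * e) v = matrixOp x (WithLp.toLp 2 fun i => e (v i)) := by
    ext i; simp [matrixOp_apply]
  rw [h1]
  refine (ContinuousLinearMap.le_opNorm _ _).trans ?_
  refine mul_le_mul_of_nonneg_left ?_ (norm_nonneg _)
  rw [PiLp.norm_eq_of_L2, PiLp.norm_eq_of_L2]
  refine Real.sqrt_le_sqrt (Finset.sum_le_sum fun i _ => ?_)
  have : ‖e (v i)‖ ≤ ‖v i‖ := (e.le_opNorm _).trans (by nlinarith [norm_nonneg (v i)])
  exact pow_le_pow_left₀ (norm_nonneg _) this 2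

/-- One-sided complete contractivity of a set of pairs. -/
def CIle (G : Submodule ℂ ((K1 →L[ℂ] K1) × (K2 →L[ℂ] K2))) : Prop :=
  ∀ (n : ℕ) (x : Fin n → Fin n → (K1 →L[ℂ] K1) × (K2 →L[ℂ] K2)), (∀ i j, x i j ∈ G) →
    ‖matrixOp (fun i j => (x i j).2)‖ ≤ ‖matrixOp (fun i j => (x i j).1)‖

/-- Multipliers of a set of pairs. -/
def Mlt (G : Submodule ℂ ((K1 →L[ℂ] K1) × (K2 →L[ℂ] K2))) :
    Submodule ℂ ((K1 →L[ℂ] K1) × (K2 →L[ℂ] K2)) where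
  carrier := {p | ∀ b ∈ G, p * b ∈ G ∧ b * p ∈ G}
  add_mem' := fun {p q} hp hq b hb => by
    rw [add_mul, mul_add]
    exact ⟨G.add_mem (hp b hb).1 (hq b hb).1, G.add_mem (hp b hb).2 (hq b hb).2⟩
  zero_mem' := fun b hb => by simp
  smul_mem' := fun c p hp b hb => by
    rw [smul_mul_assoc, mul_smul_comm]
    exact ⟨G.smul_mem _ (hp b hb).1, G.smul_mem _ (hp b hb).2⟩

/-- Approximate unit for a set of pairs. -/
def AU (G : Submodule ℂ ((K1 →L[ℂ] K1) × (K2 →L[ℂ] K2))) : Prop :=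
  ∃ (ι : Type) (l : Filter ι) (_ : l.NeBot) (e : ι → (K1 →L[ℂ] K1) × (K2 →L[ℂ] K2)),
    (∀ t, e t ∈ G) ∧ (∀ t, ‖(e t).1‖ ≤ 1) ∧ (∀ t, ‖(e t).2‖ ≤ 1) ∧
    (∀ k, Tendsto (fun t => (e t).1 k) l (𝓝 k)) ∧ (∀ k, Tendsto (fun t => (e t).2 k) l (𝓝 k)) ∧
    (∀ b ∈ G, Tendsto (fun t => e t * b) l (𝓝 b))

theorem Mlt_mul {G : Submodule ℂ ((K1 →L[ℂ] K1) × (K2 →L[ℂ] K2))} {p q}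
    (hp : p ∈ Mlt G) (hq : q ∈ Mlt G) : p * q ∈ Mlt G := fun b hb => by
  refine ⟨?_, ?_⟩
  · rw [mul_assoc]; exact (hp _ (hq b hb).1).1
  · rw [← mul_assoc]; exact (hq _ (hp b hb).2).2

theorem one_mem_Mlt {G : Submodule ℂ ((K1 →L[ℂ] K1) × (K2 →L[ℂ] K2))} : 1 ∈ Mlt G := fun b hb => by
  simp [hb]

theorem Mlt_CIle (G : Submodule ℂ ((K1 →L[ℂ] K1) × (K2 →L[ℂ] K2)))
    (hci : CIle G) (hau : AU G) : CIle (Mlt G) := by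
  intro n x hx
  obtain ⟨ι, l, hl, e, heG, he1, he2, hs1, hs2, -⟩ := hau
  refine ContinuousLinearMap.opNorm_le_bound _ (norm_nonneg _) fun v => ?_
  have key : ∀ t, ‖matrixOp (fun i j => (x i j * e t).2) v‖ ≤
      ‖matrixOp (fun i j => (x i j).1)‖ * ‖v‖ := fun t => by
    refine (ContinuousLinearMap.le_opNorm _ _).trans ?_
    refine mul_le_mul_of_nonneg_right ?_ (norm_nonneg _)
    refine (hci n (fun i j => x i j * e t) fun i j => (hx i j _ (heG t)).1).trans ?_
    exact norm_matrixOp_mul_le (fun i j => (x i j).1) (e t).1 (he1 t)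
  have lim : Tendsto (fun t => matrixOp (fun i j => (x i j * e t).2) v) l
      (𝓝 (matrixOp (fun i j => (x i j).2) v)) := by
    have h1 : ∀ t, matrixOp (fun i j => (x i j * e t).2) v =
        matrixOp (fun i j => (x i j).2) (WithLp.toLp 2 fun i => (e t).2 (v i)) := fun t => by
      ext i; simp [matrixOp_apply]
    simp_rw [h1]
    refine ((matrixOp (fun i j => (x i j).2)).continuous.tendsto _).comp ?_
    have : v = WithLp.toLp 2 fun i => v i := rfl
    conv => rhs; rw [this]
    refine ((PiLp.continuous_toLp 2 _).tendsto _).comp ?_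
    exact tendsto_pi_nhds.2 fun i => hs2 (v i)
  exact le_of_tendsto lim.norm (Eventually.of_forall key)

theorem accretive_aux {E F : Type*} [NormedAddCommGroup E] [InnerProductSpace ℂ E]
    [NormedAddCommGroup F] [InnerProductSpace ℂ F] (S : E →L[ℂ] E) (T : F →L[ℂ] F)
    (h : ∀ s : ℝ, ‖1 - (s : ℂ) • T‖ ≤ ‖1 - (s : ℂ) • S‖)
    (hS : ∀ v, 0 ≤ (inner ℂ v (S v)).re) (v : F) : 0 ≤ (inner ℂ v (T v)).re := by
  have exp : ∀ {E : Type _} [NormedAddCommGroup E] [InnerProductSpace ℂ E] (S : E →L[ℂ] E) (s : ℝ)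
      (v : E), ‖(1 - (s : ℂ) • S) v‖ ^ 2 = ‖v‖ ^ 2 - 2 * s * (inner ℂ v (S v)).re + s ^ 2 * ‖S v‖ ^ 2 := by
    intro E _ _ S s v
    have := @norm_sub_sq ℂ E _ _ _ v ((s : ℂ) • S v)
    simp only [ContinuousLinearMap.sub_apply, ContinuousLinearMap.one_apply,
      ContinuousLinearMap.smul_apply]
    rw [this, inner_smul_right, norm_smul]
    simp [mul_pow]; ring
  have exp' : ∀ (s : ℝ) (v : F), ‖(1 - (s : ℂ) • T) v‖ ^ 2 = ‖v‖ ^ 2 - 2 * s * (inner ℂ v (T v)).re + s ^ 2 * ‖T v‖ ^ 2 := by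
    intro s v
    have := @norm_sub_sq ℂ F _ _ _ v ((s : ℂ) • T v)
    simp only [ContinuousLinearMap.sub_apply, ContinuousLinearMap.one_apply,
      ContinuousLinearMap.smul_apply]
    rw [this, inner_smul_right, norm_smul]
    simp [mul_pow]; ring
  have hb : ∀ s : ℝ, 0 < s → ‖1 - (s : ℂ) • S‖ ≤ Real.sqrt (1 + s ^ 2 * ‖S‖ ^ 2) := fun s hs => by
    refine ContinuousLinearMap.opNorm_le_bound _ (Real.sqrt_nonneg _) fun u => ?_
    refine (sq_le_sq₀ (norm_nonneg _) (by positivity)).1 ?_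
    rw [exp, mul_pow, Real.sq_sqrt (by positivity)]
    have h1 := hS u
    have h2 : ‖S u‖ ^ 2 ≤ (‖S‖ * ‖u‖) ^ 2 := pow_le_pow_left₀ (norm_nonneg _) (S.le_opNorm u) 2
    have h3 : 0 ≤ s * (inner ℂ u (S u)).re := by positivity
    nlinarith [mul_le_mul_of_nonneg_left h2 (sq_nonneg s)]
  have hc : ∀ s : ℝ, 0 < s → -(s * (‖S‖ ^ 2 * ‖v‖ ^ 2)) ≤ 2 * (inner ℂ v (T v)).re := fun s hs => by
    have h1 : ‖(1 - (s : ℂ) • T) v‖ ≤ Real.sqrt (1 + s ^ 2 * ‖S‖ ^ 2) * ‖v‖ :=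
      (ContinuousLinearMap.le_opNorm _ _).trans
        (mul_le_mul_of_nonneg_right ((h s).trans (hb s hs)) (norm_nonneg _))
    have h2 := pow_le_pow_left₀ (norm_nonneg _) h1 2
    rw [exp', mul_pow, Real.sq_sqrt (by positivity)] at h2
    have h3 : 0 ≤ s ^ 2 * ‖T v‖ ^ 2 := by positivity
    have h4 : s * (-(s * (‖S‖ ^ 2 * ‖v‖ ^ 2))) ≤ s * (2 * (inner ℂ v (T v)).re) := by nlinarith
    exact le_of_mul_le_mul_left h4 hs
  have hlim : Tendsto (fun s : ℝ => -(s * (‖S‖ ^ 2 * ‖v‖ ^ 2))) (𝓝[>] 0) (𝓝 0) := by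
    have : Continuous (fun s : ℝ => -(s * (‖S‖ ^ 2 * ‖v‖ ^ 2))) := by fun_prop
    have h := this.tendsto 0
    simp only [zero_mul, neg_zero] at h
    exact h.mono_left nhdsWithin_le_nhds
  have := le_of_tendsto hlim (eventually_mem_nhdsWithin.mono fun s hs => hc s hs)
  linarith

theorem Mlt_pos (G : Submodule ℂ ((K1 →L[ℂ] K1) × (K2 →L[ℂ] K2)))
    (hci : CIle (Mlt G)) {ι : Type*} [Fintype ι]
    (x : ι → ι → (K1 →L[ℂ] K1) × (K2 →L[ℂ] K2)) (hx : ∀ i j, x i j ∈ Mlt G)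
    (hpos : ∀ v : ι → K1, 0 ≤ (∑ i, ∑ j, inner ℂ (v i) ((x i j).1 (v j))).re)
    (v : ι → K2) : 0 ≤ (∑ i, ∑ j, inner ℂ (v i) ((x i j).2 (v j))).re := by
  classical
  let f := (Fintype.equivFin ι).symm
  have key := accretive_aux (matrixOp (fun i j => (x (f i) (f j)).1))
    (matrixOp (fun i j => (x (f i) (f j)).2)) ?_ ?_ (WithLp.toLp 2 fun i => v (f i))
  · rw [matrixOp_inner] at key
    rw [← f.sum_comp]
    simp_rw [← f.sum_comp (fun j => inner ℂ _ ((x _ j).2 (v j)))]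
    simpa using key
  · intro s
    rw [← matrixOp_one_sub, ← matrixOp_one_sub]
    have := hci _ (fun i j => (if i = j then 1 else 0) - (s : ℂ) • x (f i) (f j)) fun i j => by
      refine (Mlt G).sub_mem ?_ ((Mlt G).smul_mem _ (hx _ _))
      split_ifs
      exacts [one_mem_Mlt, (Mlt G).zero_mem]
    convert this using 5 <;> split_ifs <;> simp
  · intro u
    rw [matrixOp_inner]
    have := hpos (fun i => u (f.symm i))
    rw [← f.sum_comp] at this
    simp_rw [← f.sum_comp (fun j => inner ℂ _ ((x _ j).1 (u (f.symm j))))] at this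
    simpa using this

theorem cre_symm {E : Type*} [NormedAddCommGroup E] [InnerProductSpace ℂ E] (u v : E) :
    (inner ℂ u v).re = (inner ℂ v u).re := by
  rw [← inner_conj_symm u v, Complex.conj_re]

theorem cim_symm {E : Type*} [NormedAddCommGroup E] [InnerProductSpace ℂ E] (u v : E) :
    (inner ℂ u v).im = -(inner ℂ v u).im := by
  rw [← inner_conj_symm u v, Complex.conj_im]

theorem exists_strong_limit {ι : Type*} {l : Filter ι} [l.NeBot] (c : ι → K2 →L[ℂ] K2) (C : ℝ)
    (hC : ∀ t, ‖c t‖ ≤ C) (D : Set K2) (hD : Dense D)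
    (h : ∀ u ∈ D, ∃ w, Tendsto (fun t => c t u) l (𝓝 w)) :
    ∃ T : K2 →L[ℂ] K2, ∀ k, Tendsto (fun t => c t k) l (𝓝 (T k)) := by
  have hC0 : 0 ≤ C := by
    obtain ⟨t⟩ := l.nonempty_of_neBot
    exact (norm_nonneg _).trans (hC t)
  have hlim : ∀ k, ∃ w, Tendsto (fun t => c t k) l (𝓝 w) := by
    intro k
    apply cauchy_map_iff_exists_tendsto.1
    refine Metric.cauchy_iff.2 ⟨inferInstance, fun ε hε => ?_⟩
    obtain ⟨u, hu, huk⟩ := Metric.dense_iff.1 hD k (ε / (4 * (C + 1))) (by positivity)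
    obtain ⟨w, hw⟩ := h _ huk
    refine ⟨Metric.ball w (ε / 2), ?_, fun x hx y hy => ?_⟩
    · have := hw (Metric.ball_mem_nhds w (show 0 < ε / 4 by positivity))
      refine mem_map.2 ?_
      filter_upwards [mem_map.1 this] with t ht
      have h1 : dist (c t k) (c t u) ≤ ε / 4 := by
        rw [dist_eq_norm, ← map_sub]
        refine ((c t).le_opNorm _).trans ?_
        rw [Metric.mem_ball, dist_comm, dist_eq_norm] at hu
        calc ‖c t‖ * ‖k - u‖ ≤ (C + 1) * (ε / (4 * (C + 1))) :=
              mul_le_mul ((hC t).trans (by linarith)) hu.le (norm_nonneg _) (by linarith)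
          _ = ε / 4 := by field_simp
      have h2 : dist (c t u) w < ε / 4 := ht
      have h3 := dist_triangle (c t k) (c t u) w
      show dist (c t k) w < ε / 2
      linarith
    · have := dist_triangle_right x y w
      rw [Metric.mem_ball] at hx hy
      linarith
  choose f hf using hlim
  let T := linearMapOfTendsto f (fun t => (c t : K2 →ₗ[ℂ] K2)) (tendsto_pi_nhds.2 hf)
  refine ⟨T.mkContinuous C fun k => ?_, fun k => hf k⟩
  refine le_of_tendsto (hf k).norm (Eventually.of_forall fun t => ?_)
  exact (c t).le_of_opNorm_le (hC t) k

theorem exists_lift (G : Submodule ℂ ((K1 →L[ℂ] K1) × (K2 →L[ℂ] K2)))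
    (hmul : ∀ a ∈ G, ∀ b ∈ G, a * b ∈ G) (hiso : ∀ p ∈ G, ‖p.2‖ = ‖p.1‖) (hau : AU G)
    (S : K1 →L[ℂ] K1) (hl : ∀ b ∈ G, ∃ c ∈ G, c.1 = S * b.1)
    (hr : ∀ b ∈ G, ∃ c ∈ G, c.1 = b.1 * S) : ∃ T, (S, T) ∈ Mlt G := by
  obtain ⟨ι, l, hl', e, heG, he1, he2, hs1, hs2, heb⟩ := hau
  have hinj : ∀ p ∈ G, ∀ q ∈ G, p.1 = q.1 → p = q := fun p hp q hq h => by
    have := hiso _ (G.sub_mem hp hq)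
    rw [Prod.fst_sub, h, sub_self, norm_zero, norm_eq_zero, Prod.snd_sub, sub_eq_zero] at this
    exact Prod.ext h this
  choose c hcG hc using fun t => hl (e t) (heG t)
  have hlimb : ∀ b ∈ G, ∀ d ∈ G, d.1 = S * b.1 → ∀ k,
      Tendsto (fun t => (c t).2 (b.2 k)) l (𝓝 (d.2 k)) := by
    intro b hb d hd hdb k
    have h1 : ∀ t, ‖(c t * b).2 - d.2‖ = ‖S * ((e t * b).1 - b.1)‖ := fun t => by
      have := hiso _ (G.sub_mem (hmul _ (hcG t) _ hb) hd)
      rw [Prod.snd_sub, Prod.fst_sub] at this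
      rw [this, Prod.fst_mul, hc, hdb, Prod.fst_mul, mul_sub, mul_assoc]
    have h2 : Tendsto (fun t => (c t * b).2) l (𝓝 d.2) := by
      rw [tendsto_iff_norm_sub_tendsto_zero]
      simp_rw [h1]
      have h3 : Tendsto (fun t => (e t * b).1 - b.1) l (𝓝 0) := by
        have := ((continuous_fst.tendsto _).comp (heb b hb)).sub_const b.1
        simpa using this
      have h4 := (h3.const_mul S).norm
      simpa using h4
    exact ((ContinuousLinearMap.apply ℂ K2 k).continuous.tendsto _).comp h2
  obtain ⟨T, hT⟩ := exists_strong_limit (l := l) (fun t => (c t).2) ‖S‖ (fun t => by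
      show ‖(c t).2‖ ≤ ‖S‖
      rw [hiso _ (hcG t), hc]
      refine (norm_mul_le _ _).trans ?_
      nlinarith [he1 t, norm_nonneg S]) {u | ∃ b ∈ G, ∃ k, u = b.2 k}
    (fun k => mem_closure_of_tendsto (hs2 k) (Eventually.of_forall fun t => ⟨e t, heG t, k, rfl⟩))
    (by
      rintro _ ⟨b, hb, k, rfl⟩
      obtain ⟨d, hd, hdb⟩ := hl b hb
      exact ⟨_, hlimb b hb d hd hdb k⟩)
  refine ⟨T, fun b hb => ⟨?_, ?_⟩⟩
  · obtain ⟨d, hd, hdb⟩ := hl b hb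
    convert hd
    refine Prod.ext hdb.symm ?_
    ext k
    exact tendsto_nhds_unique (hT (b.2 k)) (hlimb b hb d hd hdb k)
  · obtain ⟨d, hd, hdb⟩ := hr b hb
    convert hd
    refine Prod.ext hdb.symm ?_
    ext k
    have h1 : Tendsto (fun t => b.2 ((c t).2 k)) l (𝓝 (b.2 (T k))) :=
      (b.2.continuous.tendsto _).comp (hT k)
    have h2 : Tendsto (fun t => d.2 ((e t).2 k)) l (𝓝 (d.2 k)) :=
      (d.2.continuous.tendsto _).comp (hs2 k)
    have h3 : ∀ t, b.2 ((c t).2 k) = d.2 ((e t).2 k) := fun t => by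
      have := hinj _ (hmul _ hb _ (hcG t)) _ (hmul _ hd _ (heG t)) (by
        rw [Prod.fst_mul, Prod.fst_mul, hc, hdb, mul_assoc])
      exact DFunLike.congr_fun (congrArg Prod.snd this) k
    simp_rw [h3] at h1
    exact tendsto_nhds_unique h1 h2

theorem Mlt_adjoint (G : Submodule ℂ ((K1 →L[ℂ] K1) × (K2 →L[ℂ] K2)))
    (hci : CIle (Mlt G)) (S : K1 →L[ℂ] K1) (T T' : K2 →L[ℂ] K2) (h1 : (S, T) ∈ Mlt G)
    (h2 : (adjoint S, T') ∈ Mlt G) : T' = adjoint T := by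
  have key : ∀ u v : K2, 0 ≤ (inner ℂ u (T v)).re - (inner ℂ v (T' u)).re := by
    intro u v
    have := Mlt_pos G hci (ι := Fin 2) ![![0, (S, T)], ![-(adjoint S, T'), 0]] (by
      intro i j
      fin_cases i <;> fin_cases j
      · exact (Mlt G).zero_mem
      · exact h1
      · exact (Mlt G).neg_mem h2
      · exact (Mlt G).zero_mem) (by
      intro v
      simp [Fin.sum_univ_two, adjoint_inner_right]
      exact (cre_symm _ _).le) ![u, v]
    simpa [Fin.sum_univ_two, sub_eq_add_neg] using this
  have key2 : ∀ u v : K2, (inner ℂ u (T v)).re = (inner ℂ v (T' u)).re := by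
    intro u v
    have a := key u v
    have b := key (-u) v
    simp at b
    linarith
  refine ContinuousLinearMap.ext fun u => ext_inner_left ℂ fun v => ?_
  rw [adjoint_inner_right]
  apply Complex.ext
  · rw [← key2 u v, cre_symm]
  · have := key2 u (Complex.I • v)
    simp [inner_smul_left, inner_smul_right] at this
    rw [cim_symm (T v) u]; linarith

theorem exists_dilation {ι : Type} (κ : ι → ι → (K2 →L[ℂ] K2))
    (herm : ∀ i j, κ i j = adjoint (κ j i))
    (pos : ∀ (F : Finset ι) (v : F → K2),
      0 ≤ (∑ i : F, ∑ j : F, inner ℂ (v i) (κ i j (v j))).re) :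
    ∃ (H' : Type) (_ : NormedAddCommGroup H') (_ : InnerProductSpace ℂ H') (_ : CompleteSpace H')
      (ρ : ι → H' →L[ℂ] K2), (∀ i j, ρ i ∘L adjoint (ρ j) = κ i j) ∧
      Dense (Submodule.span ℂ {v : H' | ∃ i k, v = adjoint (ρ i) k} : Set H') := by
  let Km : Matrix ι ι (K2 →L[ℂ] K2) := Matrix.of κ
  have hp : Km.PosSemidef := by
    refine ((RKHS.posSemidef_tfae (𝕜 := ℂ) (K := Km)).out 0 2 rfl rfl).2 ⟨?_, fun vv => ?_⟩
    · ext1 i j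
      exact (herm i j).symm
    · have := pos vv.support (fun i => vv i)
      have e : (vv.sum fun x w ↦ vv.sum fun x' w' ↦ inner ℂ (Km x' x w) w') =
        (starRingEnd ℂ) (∑ i : vv.support, ∑ j : vv.support, inner ℂ (vv i) (κ i j (vv j))) := by
        rw [Finset.sum_comm]
        simp only [Finsupp.sum, map_sum, inner_conj_symm]
        rw [← Finset.sum_coe_sort]
        refine Finset.sum_congr rfl fun i _ => ?_
        rw [← Finset.sum_coe_sort]
        rfl
      rw [e, RCLike.conj_re]
      exact this
  haveI : Fact Km.PosSemidef := ⟨hp⟩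
  refine ⟨RKHS.OfKernel Km, inferInstance, inferInstance, inferInstance,
    fun i => adjoint (RKHS.kerFun (RKHS.OfKernel Km) i), fun i j => ?_, ?_⟩
  · rw [adjoint_adjoint, ← RKHS.kernel_apply, RKHS.OfKernel.kernel_ofKernel]
    rfl
  · have := RKHS.kerFun_dense (RKHS.OfKernel Km)
    rw [Submodule.dense_iff_topologicalClosure_eq_top, ← this]
    congr 2
    ext v
    simp only [adjoint_adjoint, Set.mem_setOf_eq, eq_comm]

/-- Auxiliary block matrix. -/
def blk {n : ℕ} {F : Type*} (r : F → H2 →L[ℂ] K2) (x : Fin n → Fin n → (H2 →L[ℂ] H2)) (c : ℝ) :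
    (Fin n × F) ⊕ (Fin n × F) → (Fin n × F) ⊕ (Fin n × F) → (K2 →L[ℂ] K2)
  | .inl a, .inl b => if a.1 = b.1 then ((c / 2 : ℝ) : ℂ) • (r a.2 ∘L adjoint (r b.2)) else 0
  | .inr a, .inr b => if a.1 = b.1 then ((c / 2 : ℝ) : ℂ) • (r a.2 ∘L adjoint (r b.2)) else 0
  | .inr a, .inl b => -(r a.2 ∘L (x a.1 b.1 ∘L adjoint (r b.2)))
  | .inl _, .inr _ => 0

theorem blk_diag {n : ℕ} {F : Type*} [Fintype F] (r : F → H2 →L[ℂ] K2) (c : ℝ)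
    (v : Fin n × F → K2) :
    (∑ a, ∑ b, inner ℂ (v a) ((if a.1 = b.1 then
      ((c / 2 : ℝ) : ℂ) • (r a.2 ∘L adjoint (r b.2)) else 0 : K2 →L[ℂ] K2) (v b))).re =
    c / 2 * ∑ k, ‖∑ i, adjoint (r i) (v (k, i))‖ ^ 2 := by
  have : ∀ k : Fin n, (‖∑ i, adjoint (r i) (v (k, i))‖ ^ 2 : ℝ) =
      (∑ i, ∑ j, inner ℂ (v (k, i)) ((r i) (adjoint (r j) (v (k, j))))).re := fun k => by
    rw [← @inner_self_eq_norm_sq ℂ]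
    simp only [sum_inner, inner_sum, adjoint_inner_left]
    rw [Finset.sum_comm]
    rfl
  simp_rw [this]
  simp only [Fintype.sum_prod_type]
  rw [Complex.re_sum, Finset.mul_sum]
  refine Finset.sum_congr rfl fun k _ => ?_
  rw [Complex.re_sum, Complex.re_sum, Finset.mul_sum]
  refine Finset.sum_congr rfl fun i _ => ?_
  rw [Finset.sum_eq_single k]
  · simp only [if_true, ContinuousLinearMap.smul_apply, inner_smul_right, ← Finset.mul_sum,
      Complex.re_ofReal_mul]
    rfl
  · intro l _ hl
    simp [Ne.symm hl]
  · simp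

theorem blk_form {n : ℕ} {F : Type*} [Fintype F] (r : F → H2 →L[ℂ] K2)
    (x : Fin n → Fin n → (H2 →L[ℂ] H2)) (c : ℝ) (v : (Fin n × F) ⊕ (Fin n × F) → K2)
    (ξ η : PiLp 2 fun _ : Fin n => H2) (hξ : ∀ k, ξ k = ∑ i, adjoint (r i) (v (.inl (k, i))))
    (hη : ∀ k, η k = ∑ i, adjoint (r i) (v (.inr (k, i)))) :
    (∑ a, ∑ b, inner ℂ (v a) (blk r x c a b (v b))).re =
    c / 2 * ‖ξ‖ ^ 2 + c / 2 * ‖η‖ ^ 2 - (inner ℂ η (matrixOp x ξ)).re := by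
  have h3 : inner ℂ η (matrixOp x ξ) = - ∑ a : Fin n × F, ∑ b : Fin n × F,
      inner ℂ (v (.inr a)) ((-(r a.2 ∘L (x a.1 b.1 ∘L adjoint (r b.2)))) (v (.inl b))) := by
    rw [matrixOp_inner]
    simp only [Fintype.sum_prod_type, hξ, hη, ContinuousLinearMap.neg_apply, inner_neg_right,
      Finset.sum_neg_distrib, neg_neg, ContinuousLinearMap.comp_apply, sum_inner, map_sum, inner_sum,
      adjoint_inner_left]
    refine Finset.sum_congr rfl fun k _ => ?_
    refine Eq.trans ?_ Finset.sum_comm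
    exact Finset.sum_congr rfl fun l _ => Finset.sum_comm
  have h1 := blk_diag r c (fun a => v (.inl a))
  have h2 := blk_diag r c (fun a => v (.inr a))
  simp_rw [← hξ] at h1
  simp_rw [← hη] at h2
  rw [PiLp.norm_sq_eq_of_L2, PiLp.norm_sq_eq_of_L2, ← h1, ← h2, h3]
  simp only [Fintype.sum_sum_type, blk, Finset.sum_add_distrib, Complex.add_re, Complex.neg_re]
  simp
  ring

theorem common_rep {τ : Type*} [Fintype τ] {I : Type*} (r : I → H2 →L[ℂ] K2) (z : τ → H2)
    (hz : ∀ a, z a ∈ Submodule.span ℂ {v : H2 | ∃ i k, v = adjoint (r i) k}) :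
    ∃ (F : Finset I) (u : τ → F → K2), ∀ a, z a = ∑ i : F, adjoint (r i) (u a i) := by
  classical
  have h1 : ∀ a, ∃ f : I →₀ K2, z a = f.sum fun i k => adjoint (r i) k := by
    intro a
    have hza := hz a
    generalize z a = y at hza
    induction hza using Submodule.span_induction with
    | mem x hx =>
      obtain ⟨i, k, rfl⟩ := hx
      exact ⟨Finsupp.single i k, by simp⟩
    | zero => exact ⟨0, by simp⟩
    | add x y _ _ hx hy =>
      obtain ⟨f, rfl⟩ := hx
      obtain ⟨g, rfl⟩ := hy
      exact ⟨f + g, by rw [Finsupp.sum_add_index'] <;> simp⟩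
    | smul c x _ hx =>
      obtain ⟨f, rfl⟩ := hx
      exact ⟨c • f, by rw [Finsupp.sum_smul_index'] <;> simp [Finsupp.smul_sum]⟩
  choose f hf using h1
  refine ⟨Finset.univ.biUnion fun a => (f a).support, fun a i => f a i, fun a => ?_⟩
  rw [hf a, Finset.sum_coe_sort _ (fun i => adjoint (r i) (f a i))]
  refine Finsupp.sum_of_support_subset _ ?_ _ (by simp)
  exact Finset.subset_biUnion_of_mem (fun a => (f a).support) (Finset.mem_univ a)

theorem norm_le_of_form {E : Type*} [NormedAddCommGroup E] [InnerProductSpace ℂ E] (X : E →L[ℂ] E)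
    (c : ℝ) (hc : 0 < c) (D : Set E) (hD : Dense D)
    (h : ∀ ξ ∈ D, ∀ η ∈ D, 0 ≤ c / 2 * ‖ξ‖ ^ 2 + c / 2 * ‖η‖ ^ 2 - (inner ℂ η (X ξ)).re) :
    ‖X‖ ≤ c := by
  have h2 : ∀ p : E × E,
      0 ≤ c / 2 * ‖p.1‖ ^ 2 + c / 2 * ‖p.2‖ ^ 2 - (inner ℂ p.2 (X p.1)).re := by
    intro p
    have hcl : IsClosed {p : E × E |
        0 ≤ c / 2 * ‖p.1‖ ^ 2 + c / 2 * ‖p.2‖ ^ 2 - (inner ℂ p.2 (X p.1)).re} := by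
      refine isClosed_le continuous_const ?_
      refine Continuous.sub (by fun_prop) ?_
      exact Complex.continuous_re.comp (by fun_prop)
    exact hcl.closure_subset_iff.2 (fun q hq => h q.1 hq.1 q.2 hq.2) (hD.prod hD p)
  refine ContinuousLinearMap.opNorm_le_bound _ hc.le fun ξ => ?_
  have h3 := h2 (ξ, ((c⁻¹ : ℝ) : ℂ) • X ξ)
  simp only [inner_smul_left, norm_smul, Complex.conj_ofReal, Complex.re_ofReal_mul,
    Complex.norm_real, Real.norm_eq_abs, abs_inv, abs_of_pos hc] at h3
  have h4 : (inner ℂ (X ξ) (X ξ)).re = ‖X ξ‖ ^ 2 := @inner_self_eq_norm_sq ℂ _ _ _ _ (X ξ)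
  rw [h4] at h3
  refine (sq_le_sq₀ (norm_nonneg _) (by positivity)).1 ?_
  have h5 : c / 2 * ‖ξ‖ ^ 2 + c / 2 * (c⁻¹ * ‖X ξ‖) ^ 2 - c⁻¹ * ‖X ξ‖ ^ 2
      = (2 * c)⁻¹ * ((c * ‖ξ‖) ^ 2 - ‖X ξ‖ ^ 2) := by field_simp; ring
  rw [h5] at h3
  have := (mul_nonneg_iff_of_pos_left (by positivity)).1 h3
  linarith

theorem Q_CIle (G : Submodule ℂ ((K1 →L[ℂ] K1) × (K2 →L[ℂ] K2))) (hci : CIle (Mlt G))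
    {I : Type*} (r1 : I → H1 →L[ℂ] K1) (r2 : I → H2 →L[ℂ] K2)
    (hR : ∀ i j, (r1 i ∘L adjoint (r1 j), r2 i ∘L adjoint (r2 j)) ∈ Mlt G)
    (hd : Dense (Submodule.span ℂ {v : H2 | ∃ i k, v = adjoint (r2 i) k} : Set H2))
    (Q : Submodule ℂ ((H1 →L[ℂ] H1) × (H2 →L[ℂ] H2)))
    (hQ : ∀ x ∈ Q, ∀ i j, (r1 i ∘L (x.1 ∘L adjoint (r1 j)), r2 i ∘L (x.2 ∘L adjoint (r2 j))) ∈ Mlt G) :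
    CIle Q := by
  intro n x hx
  refine le_of_forall_gt fun c' hc' => ?_
  obtain ⟨c, hc, hcc'⟩ := exists_between hc'
  refine lt_of_le_of_lt ?_ hcc'
  have hc0 : 0 < c := lt_of_le_of_lt (norm_nonneg _) hc
  refine norm_le_of_form _ c hc0
    {ξ | ∀ k, ξ k ∈ Submodule.span ℂ {v : H2 | ∃ i k, v = adjoint (r2 i) k}} ?_ ?_
  · have h1 := dense_pi (Set.univ : Set (Fin n)) (fun _ _ => hd)
    have h2 := h1.preimage (PiLp.homeomorph 2 (fun _ : Fin n => H2)).isOpenMap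
    refine h2.mono fun ξ hξ k => ?_
    exact hξ k trivial
  · intro ξ hξ η hη
    obtain ⟨F, u, hu⟩ := common_rep r2 (Sum.elim (fun k => ξ k) (fun k => η k)) (by
      rintro (a | a)
      exacts [hξ a, hη a])
    have key := Mlt_pos G hci (ι := (Fin n × F) ⊕ (Fin n × F))
      (fun a b => (blk (fun i : F => r1 i) (fun i j => (x i j).1) c a b,
        blk (fun i : F => r2 i) (fun i j => (x i j).2) c a b)) ?_ ?_
      (Sum.elim (fun p => u (.inl p.1) p.2) (fun p => u (.inr p.1) p.2))
    · rw [blk_form _ _ _ _ ξ η (fun k => by simpa using hu (.inl k))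
        (fun k => by simpa using hu (.inr k))] at key
      exact key
    · rintro (a | a) (b | b)
      · by_cases h : a.1 = b.1
        · simp only [blk, h, if_true]
          exact (Mlt G).smul_mem _ (hR a.2 b.2)
        · simp only [blk, h, if_false]
          exact (Mlt G).zero_mem
      · exact (Mlt G).zero_mem
      · exact (Mlt G).neg_mem (hQ _ (hx _ _) _ _)
      · by_cases h : a.1 = b.1
        · simp only [blk, h, if_true]
          exact (Mlt G).smul_mem _ (hR a.2 b.2)
        · simp only [blk, h, if_false]
          exact (Mlt G).zero_mem
    · intro v
      show 0 ≤ (∑ a, ∑ b, inner ℂ (v a) (blk (fun i : F => r1 i) (fun i j => (x i j).1) c a b (v b))).re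
      rw [blk_form _ _ _ _
        (WithLp.toLp 2 fun k => ∑ i : F, adjoint (r1 i) (v (.inl (k, i))))
        (WithLp.toLp 2 fun k => ∑ i : F, adjoint (r1 i) (v (.inr (k, i)))) (fun k => rfl) (fun k => rfl)]
      generalize (WithLp.toLp 2 fun k => ∑ i : F, adjoint (r1 i) (v (.inl (k, i))) :
        PiLp 2 fun _ : Fin n => H1) = p
      generalize (WithLp.toLp 2 fun k => ∑ i : F, adjoint (r1 i) (v (.inr (k, i))) :
        PiLp 2 fun _ : Fin n => H1) = q
      have a1 : (inner ℂ q (matrixOp (fun i j => (x i j).1) p)).re ≤ ‖q‖ * (c * ‖p‖) := by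
        refine (Complex.re_le_norm _).trans ((norm_inner_le_norm _ _).trans ?_)
        exact mul_le_mul_of_nonneg_left (ContinuousLinearMap.le_of_opNorm_le _ hc.le _) (norm_nonneg _)
      nlinarith [mul_nonneg hc0.le (sq_nonneg (‖p‖ - ‖q‖))]

/-- Swap a submodule of pairs. -/
def sw (G : Submodule ℂ ((K1 →L[ℂ] K1) × (K2 →L[ℂ] K2))) :
    Submodule ℂ ((K2 →L[ℂ] K2) × (K1 →L[ℂ] K1)) where
  carrier := {p | p.swap ∈ G}
  add_mem' := fun hp hq => G.add_mem hp hq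
  zero_mem' := G.zero_mem
  smul_mem' := fun c _ hp => G.smul_mem c hp

theorem mem_sw {G : Submodule ℂ ((K1 →L[ℂ] K1) × (K2 →L[ℂ] K2))} {p} :
    p ∈ sw G ↔ p.swap ∈ G := Iff.rfl

theorem Mlt_sw (G : Submodule ℂ ((K1 →L[ℂ] K1) × (K2 →L[ℂ] K2))) : Mlt (sw G) = sw (Mlt G) := by
  ext p
  refine ⟨fun h b hb => h b.swap hb, fun h b hb => h b.swap hb⟩

theorem AU_sw {G : Submodule ℂ ((K1 →L[ℂ] K1) × (K2 →L[ℂ] K2))} (h : AU G) : AU (sw G) := by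
  obtain ⟨ι, l, hl, e, h1, h2, h3, h4, h5, h6⟩ := h
  refine ⟨ι, l, hl, fun t => (e t).swap, h1, h3, h2, h5, h4, fun b hb => ?_⟩
  exact (continuous_swap.tendsto _).comp (h6 b.swap hb)

theorem norm_eq_of_CI {G : Submodule ℂ ((K1 →L[ℂ] K1) × (K2 →L[ℂ] K2))} (h : CIle G)
    (h' : CIle (sw G)) (p) (hp : p ∈ G) : ‖p.2‖ = ‖p.1‖ := by
  have a := h 1 (fun _ _ => p) (fun _ _ => hp)
  have b := h' 1 (fun _ _ => p.swap) (fun _ _ => hp)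
  rw [norm_matrixOp_fin1, norm_matrixOp_fin1] at a b
  exact le_antisymm a b

section gen
variable {E F : Type*} [NormedAddCommGroup E] [NormedSpace ℂ E]
  [NormedAddCommGroup F] [NormedSpace ℂ F]

theorem clspan_eq (S : Set E) : clspan S = ((Submodule.span ℂ S).topologicalClosure : Set E) := rfl

theorem subset_clspan (S : Set E) : S ⊆ clspan S :=
  Submodule.subset_span.trans subset_closure

theorem clspan_subset {S T : Set E} (hT : IsClosedSubspace T) (h : S ⊆ T) : clspan S ⊆ T := by
  obtain ⟨hc, p, rfl⟩ := hT
  exact closure_minimal (Submodule.span_le.2 h) hc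

theorem clspan_closedSubspace (S : Set E) : IsClosedSubspace (clspan S) :=
  ⟨isClosed_closure, (Submodule.span ℂ S).topologicalClosure, rfl⟩

theorem IsClosedSubspace.preimage (f : E →L[ℂ] F) {T : Set F} (hT : IsClosedSubspace T) :
    IsClosedSubspace (f ⁻¹' T) := by
  obtain ⟨hc, p, rfl⟩ := hT
  exact ⟨hc.preimage f.continuous, p.comap f.toLinearMap, rfl⟩

theorem clspan_map (f : E →L[ℂ] F) {S : Set E} {T : Set F} (hT : IsClosedSubspace T)
    (h : ∀ s ∈ S, f s ∈ T) : ∀ s ∈ clspan S, f s ∈ T :=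
  clspan_subset (hT.preimage f) h

theorem fst_image_clspan [CompleteSpace E] [CompleteSpace F] (S : Set (E × F))
    (h : ∀ p ∈ clspan S, ‖p.2‖ = ‖p.1‖) :
    Prod.fst '' clspan S = clspan (Prod.fst '' S) := by
  apply Set.Subset.antisymm
  · rintro _ ⟨p, hp, rfl⟩
    exact clspan_map (ContinuousLinearMap.fst ℂ E F) (clspan_closedSubspace _)
      (fun s hs => subset_clspan _ (Set.mem_image_of_mem _ hs)) p hp
  · refine clspan_subset (T := Prod.fst '' clspan S)
      ⟨?_, ((Submodule.span ℂ S).topologicalClosure).map (LinearMap.fst ℂ E F), ?_⟩ ?_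
    · let Q := (Submodule.span ℂ S).topologicalClosure
      have hQ : IsClosed (Q : Set (E × F)) := isClosed_closure
      haveI : CompleteSpace Q := hQ.completeSpace_coe
      let f : Q →ₗᵢ[ℂ] E := ⟨(LinearMap.fst ℂ E F).comp Q.subtype, fun p => by
        show ‖p.1.1‖ = max ‖p.1.1‖ ‖p.1.2‖
        rw [h p.1 p.2, max_self]⟩
      have := f.isometry.isClosedEmbedding.isClosed_range
      convert this using 1
      ext x
      constructor
      · rintro ⟨p, hp, rfl⟩; exact ⟨⟨p, hp⟩, rfl⟩
      · rintro ⟨p, rfl⟩; exact ⟨p.1, p.2, rfl⟩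
    · rfl
    · exact Set.image_mono (subset_clspan S)

theorem snd_image_clspan [CompleteSpace E] [CompleteSpace F] (S : Set (E × F))
    (h : ∀ p ∈ clspan S, ‖p.2‖ = ‖p.1‖) :
    Prod.snd '' clspan S = clspan (Prod.snd '' S) := by
  apply Set.Subset.antisymm
  · rintro _ ⟨p, hp, rfl⟩
    exact clspan_map (ContinuousLinearMap.snd ℂ E F) (clspan_closedSubspace _)
      (fun s hs => subset_clspan _ (Set.mem_image_of_mem _ hs)) p hp
  · refine clspan_subset (T := Prod.snd '' clspan S)
      ⟨?_, ((Submodule.span ℂ S).topologicalClosure).map (LinearMap.snd ℂ E F), ?_⟩ ?_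
    · let Q := (Submodule.span ℂ S).topologicalClosure
      have hQ : IsClosed (Q : Set (E × F)) := isClosed_closure
      haveI : CompleteSpace Q := hQ.completeSpace_coe
      let f : Q →ₗᵢ[ℂ] F := ⟨(LinearMap.snd ℂ E F).comp Q.subtype, fun p => by
        show ‖p.1.2‖ = max ‖p.1.1‖ ‖p.1.2‖
        rw [h p.1 p.2, max_self]⟩
      have := f.isometry.isClosedEmbedding.isClosed_range
      convert this using 1
      ext x
      constructor
      · rintro ⟨p, hp, rfl⟩; exact ⟨⟨p, hp⟩, rfl⟩
      · rintro ⟨p, rfl⟩; exact ⟨p.1, p.2, rfl⟩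
    · rfl
    · exact Set.image_mono (subset_clspan S)
end gen

/-- `x ↦ a x b` as a continuous linear map. -/
def sandw {E1 E2 E3 E4 : Type} [NormedAddCommGroup E1] [InnerProductSpace ℂ E1]
    [NormedAddCommGroup E2] [InnerProductSpace ℂ E2] [NormedAddCommGroup E3] [InnerProductSpace ℂ E3]
    [NormedAddCommGroup E4] [InnerProductSpace ℂ E4]
    (a : E3 →L[ℂ] E4) (b : E1 →L[ℂ] E2) : (E2 →L[ℂ] E3) →L[ℂ] (E1 →L[ℂ] E4) :=
  (ContinuousLinearMap.compL ℂ E1 E3 E4 a).comp ((ContinuousLinearMap.compL ℂ E1 E2 E3).flip b)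

theorem sandw_apply {E1 E2 E3 E4 : Type} [NormedAddCommGroup E1] [InnerProductSpace ℂ E1]
    [NormedAddCommGroup E2] [InnerProductSpace ℂ E2] [NormedAddCommGroup E3] [InnerProductSpace ℂ E3]
    [NormedAddCommGroup E4] [InnerProductSpace ℂ E4]
    (a : E3 →L[ℂ] E4) (b : E1 →L[ℂ] E2) (x) : sandw a b x = a ∘L (x ∘L b) := rfl

theorem TRO_comp (Rr : Set (H2 →L[ℂ] K2)) (N : Set (K2 →L[ℂ] L2)) (hN : IsTRO N)
    (X : Set (H2 →L[ℂ] H2)) (Y : Set (K2 →L[ℂ] K2)) (Z : Set (L2 →L[ℂ] L2))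
    (hX : X = conjTRO Rr Y) (hY : Y = conjTRO' Rr X)
    (hY' : Y = conjTRO N Z) (hZ : Z = conjTRO' N Y)
    (hW : ∀ r ∈ Rr, ∀ s ∈ Rr, ∀ y ∈ Y, (r ∘L adjoint s) * y ∈ Y ∧ y * (r ∘L adjoint s) ∈ Y) :
    StronglyTROEquivalent X Z := by
  let W : Set (K2 →L[ℂ] K2) := {w | ∀ y ∈ Y, w * y ∈ Y ∧ y * w ∈ Y ∧ adjoint w * y ∈ Y ∧
    y * adjoint w ∈ Y}
  have hYs : IsClosedSubspace Y := hY ▸ clspan_closedSubspace _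
  have hXs : IsClosedSubspace X := hX ▸ clspan_closedSubspace _
  have hZs : IsClosedSubspace Z := hZ ▸ clspan_closedSubspace _
  have W1 : (1 : K2 →L[ℂ] K2) ∈ W := fun y hy => by
    rw [← star_eq_adjoint, star_one]; simp [hy]
  have Wm : ∀ v ∈ W, ∀ w ∈ W, v * w ∈ W := fun v hv w hw y hy => by
    rw [← star_eq_adjoint, star_mul, star_eq_adjoint, star_eq_adjoint]
    refine ⟨?_, ?_, ?_, ?_⟩
    · rw [mul_assoc]; exact (hv _ (hw _ hy).1).1
    · rw [← mul_assoc]; exact (hw _ (hv _ hy).2.1).2.1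
    · rw [mul_assoc]; exact (hw _ (hv _ hy).2.2.1).2.2.1
    · rw [← mul_assoc]; exact (hv _ (hw _ hy).2.2.2).2.2.2
  have Ws : ∀ w ∈ W, adjoint w ∈ W := fun w hw y hy => by
    rw [adjoint_adjoint]
    exact ⟨(hw y hy).2.2.1, (hw y hy).2.2.2, (hw y hy).1, (hw y hy).2.1⟩
  have WR : ∀ r ∈ Rr, ∀ s ∈ Rr, r ∘L adjoint s ∈ W := fun r hr s hs y hy => by
    rw [adjoint_comp, adjoint_adjoint]
    exact ⟨(hW r hr s hs y hy).1, (hW r hr s hs y hy).2, (hW s hs r hr y hy).1,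
      (hW s hs r hr y hy).2⟩
  have hNN : ∀ m ∈ N, ∀ n ∈ N, ∀ y ∈ Y, (adjoint m ∘L n) * y ∈ Y ∧ y * (adjoint m ∘L n) ∈ Y := by
    intro m hm n hn y hy
    rw [hY'] at hy
    refine ⟨clspan_map (sandw (adjoint m ∘L n) (ContinuousLinearMap.id ℂ K2)) hYs ?_ y hy,
      clspan_map (sandw (ContinuousLinearMap.id ℂ K2) (adjoint m ∘L n)) hYs ?_ y hy⟩
    · rintro _ ⟨p, hp, q, hq, z, hz, rfl⟩
      rw [hY']
      refine subset_clspan _ ⟨_, hN.2 p hp n hn m hm, q, hq, z, hz, ?_⟩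
      simp only [sandw_apply, adjoint_comp, adjoint_adjoint, ContinuousLinearMap.comp_id]
      rfl
    · rintro _ ⟨p, hp, q, hq, z, hz, rfl⟩
      rw [hY']
      refine subset_clspan _ ⟨p, hp, _, hN.2 q hq m hm n hn, z, hz, ?_⟩
      simp only [sandw_apply, ContinuousLinearMap.id_comp]
      rfl
  have WN : ∀ m ∈ N, ∀ n ∈ N, adjoint m ∘L n ∈ W := fun r hr s hs y hy => by
    rw [adjoint_comp, adjoint_adjoint]
    exact ⟨(hNN r hr s hs y hy).1, (hNN r hr s hs y hy).2, (hNN s hs r hr y hy).1,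
      (hNN s hs r hr y hy).2⟩
  let P0 : Set (H2 →L[ℂ] L2) := {p | ∃ n ∈ N, ∃ w ∈ W, ∃ r ∈ Rr, p = n ∘L (w ∘L r)}
  let P := clspan P0
  have hPs : IsClosedSubspace P := clspan_closedSubspace _
  have adjmap : ∀ {E G : Type} [NormedAddCommGroup E] [InnerProductSpace ℂ E] [CompleteSpace E]
      [NormedAddCommGroup G] [InnerProductSpace ℂ G] [CompleteSpace G]
      (T : Set (E →L[ℂ] G)), IsClosedSubspace T → IsClosedSubspace (adjoint ⁻¹' T) := by
    intro E G _ _ _ _ _ _ T hT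
    obtain ⟨hc, p, rfl⟩ := hT
    refine ⟨hc.preimage adjoint.continuous, ?_⟩
    refine ⟨⟨⟨⟨adjoint ⁻¹' p, ?_⟩, ?_⟩, ?_⟩, rfl⟩
    · intro a b ha hb
      simp only [Set.mem_preimage, map_add]
      exact p.add_mem ha hb
    · simp
    · intro c a ha
      simp only [Set.mem_preimage, map_smulₛₗ]
      exact p.smul_mem _ ha
  refine ⟨P, ⟨hPs, ?_⟩, ?_, ?_⟩
  · -- ternary
    have s1 : ∀ a ∈ P0, ∀ b ∈ P0, ∀ c ∈ P0, a ∘L (adjoint b ∘L c) ∈ P := by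
      rintro _ ⟨n, hn, w, hw, r, hr, rfl⟩ _ ⟨n', hn', w', hw', r', hr', rfl⟩
        _ ⟨n'', hn'', w'', hw'', r'', hr'', rfl⟩
      refine subset_clspan _ ⟨n, hn, w * (r ∘L adjoint r') * adjoint w' * (adjoint n' ∘L n'') * w'',
        Wm _ (Wm _ (Wm _ (Wm _ hw _ (WR _ hr _ hr')) _ (Ws _ hw')) _ (WN _ hn' _ hn'')) _ hw'',
        r'', hr'', ?_⟩
      simp only [adjoint_comp]
      rfl
    have s2 : ∀ a ∈ P0, ∀ b ∈ P0, ∀ c ∈ P, a ∘L (adjoint b ∘L c) ∈ P := fun a ha b hb =>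
      clspan_map (sandw (a ∘L adjoint b) (ContinuousLinearMap.id ℂ H2)) hPs (fun c hc => s1 a ha b hb c hc)
    have s3 : ∀ b ∈ P0, ∀ c ∈ P, ∀ a ∈ P, a ∘L (adjoint b ∘L c) ∈ P := fun b hb c hc =>
      clspan_map (sandw (ContinuousLinearMap.id ℂ L2) (adjoint b ∘L c)) hPs (fun a ha => s2 a ha b hb c hc)
    intro a ha b hb c hc
    have : clspan P0 ⊆ adjoint ⁻¹' ((sandw a c) ⁻¹' P) :=
      clspan_subset (adjmap _ (hPs.preimage _)) (fun b hb => s3 b hb c hc a ha)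
    exact this hb
  · apply Set.Subset.antisymm
    · -- X ⊆ P* Z P
      rw [hX]
      refine clspan_subset (clspan_closedSubspace _) ?_
      rintro _ ⟨r, hr, s, hs, y, hy, rfl⟩
      rw [hY'] at hy
      refine clspan_map (sandw (adjoint r) s) (clspan_closedSubspace _) ?_ y hy
      rintro _ ⟨m, hm, n, hn, z, hz, rfl⟩
      refine subset_clspan _ ⟨m ∘L (1 ∘L r), subset_clspan _ ⟨m, hm, 1, W1, r, hr, rfl⟩,
        n ∘L (1 ∘L s), subset_clspan _ ⟨n, hn, 1, W1, s, hs, rfl⟩, z, hz, ?_⟩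
      simp only [sandw_apply, adjoint_comp]
      rw [← star_eq_adjoint (1 : K2 →L[ℂ] K2), star_one]
      rfl
    · refine clspan_subset hXs ?_
      rintro _ ⟨p, hp, q, hq, z, hz, rfl⟩
      have s1 : ∀ a ∈ P0, ∀ b ∈ P0, adjoint a ∘L (z ∘L b) ∈ X := by
        rintro _ ⟨n, hn, w, hw, r, hr, rfl⟩ _ ⟨n', hn', w', hw', r', hr', rfl⟩
        have hy : adjoint n ∘L (z ∘L n') ∈ Y := by
          rw [hY']; exact subset_clspan _ ⟨n, hn, n', hn', z, hz, rfl⟩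
        rw [hX]
        refine subset_clspan _ ⟨r, hr, r', hr', adjoint w * (adjoint n ∘L (z ∘L n')) * w',
          (hw' _ (hw _ hy).2.2.1).2.1, ?_⟩
        simp only [adjoint_comp]
        rfl
      have s2 : ∀ a ∈ P0, adjoint a ∘L (z ∘L q) ∈ X := fun a ha =>
        clspan_map (sandw (adjoint a ∘L z) (ContinuousLinearMap.id ℂ H2)) hXs
          (fun b hb => s1 a ha b hb) q hq
      have : clspan P0 ⊆ adjoint ⁻¹' ((sandw (ContinuousLinearMap.id ℂ H2) (z ∘L q)) ⁻¹' X) :=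
        clspan_subset (adjmap _ (hXs.preimage _)) s2
      exact this hp
  · apply Set.Subset.antisymm
    · rw [hZ]
      refine clspan_subset (clspan_closedSubspace _) ?_
      rintro _ ⟨m, hm, n, hn, y, hy, rfl⟩
      rw [hY] at hy
      refine clspan_map (sandw m (adjoint n)) (clspan_closedSubspace _) ?_ y hy
      rintro _ ⟨r, hr, s, hs, x, hx, rfl⟩
      refine subset_clspan _ ⟨m ∘L (1 ∘L r), subset_clspan _ ⟨m, hm, 1, W1, r, hr, rfl⟩,
        n ∘L (1 ∘L s), subset_clspan _ ⟨n, hn, 1, W1, s, hs, rfl⟩, x, hx, ?_⟩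
      simp only [sandw_apply, adjoint_comp]
      rw [← star_eq_adjoint (1 : K2 →L[ℂ] K2), star_one]
      rfl
    · refine clspan_subset hZs ?_
      rintro _ ⟨p, hp, q, hq, x, hx, rfl⟩
      have s1 : ∀ a ∈ P0, ∀ b ∈ P0, a ∘L (x ∘L adjoint b) ∈ Z := by
        rintro _ ⟨n, hn, w, hw, r, hr, rfl⟩ _ ⟨n', hn', w', hw', r', hr', rfl⟩
        have hy : r ∘L (x ∘L adjoint r') ∈ Y := by
          rw [hY]; exact subset_clspan _ ⟨r, hr, r', hr', x, hx, rfl⟩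
        rw [hZ]
        refine subset_clspan _ ⟨n, hn, n', hn', w * (r ∘L (x ∘L adjoint r')) * adjoint w',
          (hw' _ (hw _ hy).1).2.2.2, ?_⟩
        simp only [adjoint_comp]
        rfl
      have s2 : ∀ b ∈ P0, p ∘L (x ∘L adjoint b) ∈ Z := fun b hb =>
        clspan_map (sandw (ContinuousLinearMap.id ℂ L2) (x ∘L adjoint b)) hZs
          (fun a ha => s1 a ha b hb) p hp
      have : clspan P0 ⊆ adjoint ⁻¹' ((sandw (p ∘L x) (ContinuousLinearMap.id ℂ L2)) ⁻¹' Z) :=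
        clspan_subset (adjmap _ (hZs.preimage _)) s2
      exact this hq

theorem image_closedSubspace (G : Submodule ℂ ((K1 →L[ℂ] K1) × (K2 →L[ℂ] K2)))
    (hcl : IsClosed (G : Set ((K1 →L[ℂ] K1) × (K2 →L[ℂ] K2)))) (hiso : ∀ p ∈ G, ‖p.2‖ = ‖p.1‖) :
    IsClosedSubspace (Prod.fst '' (G : Set ((K1 →L[ℂ] K1) × (K2 →L[ℂ] K2)))) ∧
    IsClosedSubspace (Prod.snd '' (G : Set ((K1 →L[ℂ] K1) × (K2 →L[ℂ] K2)))) := by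
  have e : clspan (G : Set ((K1 →L[ℂ] K1) × (K2 →L[ℂ] K2))) = G := by
    rw [clspan, Submodule.span_eq, hcl.closure_eq]
  have h : ∀ p ∈ clspan (G : Set ((K1 →L[ℂ] K1) × (K2 →L[ℂ] K2))), ‖p.2‖ = ‖p.1‖ := by
    rw [e]; exact hiso
  have h1 := fst_image_clspan _ h
  have h2 := snd_image_clspan _ h
  rw [e] at h1 h2
  rw [h1, h2]
  exact ⟨clspan_closedSubspace _, clspan_closedSubspace _⟩

theorem transfer (G : Submodule ℂ ((K1 →L[ℂ] K1) × (K2 →L[ℂ] K2)))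
    (hmul : ∀ a ∈ G, ∀ b ∈ G, a * b ∈ G)
    (hcl : IsClosed (G : Set ((K1 →L[ℂ] K1) × (K2 →L[ℂ] K2))))
    (hci : CIle G) (hci' : CIle (sw G)) (hau : AU G) (M : Set (H1 →L[ℂ] K1)) (hM : IsTRO M)
    (X : Set (H1 →L[ℂ] H1)) (Y1 : Set (K1 →L[ℂ] K1)) (Y2 : Set (K2 →L[ℂ] K2))
    (hY1 : Y1 = Prod.fst '' (G : Set ((K1 →L[ℂ] K1) × (K2 →L[ℂ] K2))))
    (hY2 : Y2 = Prod.snd '' (G : Set ((K1 →L[ℂ] K1) × (K2 →L[ℂ] K2))))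
    (hX : X = conjTRO M Y1) (hY : Y1 = conjTRO' M X) (hXd : Nondegenerate X) :
    ∃ (H' : Type) (_ : NormedAddCommGroup H') (_ : InnerProductSpace ℂ H') (_ : CompleteSpace H')
      (Q : Submodule ℂ ((H1 →L[ℂ] H1) × (H' →L[ℂ] H'))) (Rr : Set (H' →L[ℂ] K2))
      (X' : Set (H' →L[ℂ] H')), CIle Q ∧ CIle (sw Q) ∧ (∀ a ∈ Q, ∀ b ∈ Q, a * b ∈ Q) ∧
      Prod.fst '' (Q : Set ((H1 →L[ℂ] H1) × (H' →L[ℂ] H'))) = X ∧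
      Prod.snd '' (Q : Set ((H1 →L[ℂ] H1) × (H' →L[ℂ] H'))) = X' ∧
      X' = conjTRO Rr Y2 ∧ Y2 = conjTRO' Rr X' ∧
      (∀ r ∈ Rr, ∀ s ∈ Rr, ∀ y ∈ Y2, (r ∘L adjoint s) * y ∈ Y2 ∧ y * (r ∘L adjoint s) ∈ Y2) ∧
      Nondegenerate X' := by
  have hiso := norm_eq_of_CI hci hci'
  obtain ⟨hY1s, hY2s⟩ := image_closedSubspace G hcl hiso
  rw [← hY1] at hY1s
  rw [← hY2] at hY2s
  have hGs : IsClosedSubspace (G : Set ((K1 →L[ℂ] K1) × (K2 →L[ℂ] K2))) := ⟨hcl, G, rfl⟩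
  have memY1 : ∀ y, y ∈ Y1 ↔ ∃ b ∈ G, b.1 = y := fun y => by rw [hY1]; rfl
  have memY2 : ∀ y, y ∈ Y2 ↔ ∃ b ∈ G, b.2 = y := fun y => by rw [hY2]; rfl
  have hGM : ∀ b ∈ G, b ∈ Mlt G := fun b hb c hc => ⟨hmul _ hb _ hc, hmul _ hc _ hb⟩
  have hMci := Mlt_CIle G hci hau
  have hMci' : CIle (Mlt (sw G)) := Mlt_CIle (sw G) hci' (AU_sw hau)
  -- multipliers
  have hlift : ∀ i j : M, ∃ T, (i.1 ∘L adjoint j.1, T) ∈ Mlt G := by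
    intro i j
    apply exists_lift G hmul hiso hau
    · intro b hb
      have hb1 : b.1 ∈ Y1 := (memY1 _).2 ⟨b, hb, rfl⟩
      rw [hY] at hb1
      refine (memY1 _).1 (clspan_map (sandw (i.1 ∘L adjoint j.1) (ContinuousLinearMap.id ℂ K1))
        hY1s ?_ b.1 hb1)
      rintro _ ⟨p, hp, q, hq, x, hx, rfl⟩
      rw [hY]
      exact subset_clspan _ ⟨_, hM.2 i i.2 j j.2 p hp, q, hq, x, hx, rfl⟩
    · intro b hb
      have hb1 : b.1 ∈ Y1 := (memY1 _).2 ⟨b, hb, rfl⟩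
      rw [hY] at hb1
      refine (memY1 _).1 (clspan_map (sandw (ContinuousLinearMap.id ℂ K1) (i.1 ∘L adjoint j.1))
        hY1s ?_ b.1 hb1)
      rintro _ ⟨p, hp, q, hq, x, hx, rfl⟩
      rw [hY]
      refine subset_clspan _ ⟨p, hp, _, hM.2 j j.2 i i.2 q hq, x, hx, ?_⟩
      simp only [sandw_apply, adjoint_comp, adjoint_adjoint]
      rfl
  choose κ hκ using hlift
  obtain ⟨H', i1, i2, i3, ρ, hρ, hd2⟩ := exists_dilation (ι := M) κ
    (fun i j => by
      refine Mlt_adjoint G hMci _ _ _ (hκ j i) ?_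
      rw [adjoint_comp, adjoint_adjoint]
      exact hκ i j)
    (fun F v => by
      refine Mlt_pos G hMci (ι := F) (fun i j => (i.1.1 ∘L adjoint j.1.1, κ i j))
        (fun i j => hκ _ _) (fun v => ?_) v
      have : (∑ i : F, ∑ j : F, inner ℂ (v i) ((i.1.1 ∘L adjoint j.1.1) (v j))) =
          inner ℂ (∑ i : F, adjoint i.1.1 (v i)) (∑ i : F, adjoint i.1.1 (v i)) := by
        simp only [sum_inner, inner_sum, adjoint_inner_left, ContinuousLinearMap.comp_apply]
        exact Finset.sum_comm
      rw [this]
      exact @inner_self_nonneg ℂ _ _ _ _ _)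
  have hR : ∀ i j : M, (i.1 ∘L adjoint j.1, ρ i ∘L adjoint (ρ j)) ∈ Mlt G := fun i j => by
    rw [hρ]; exact hκ i j
  have hd1 : Dense (Submodule.span ℂ {v : H1 | ∃ (i : M) (k : K1), v = adjoint i.1 k} : Set H1) := by
    have : (Submodule.span ℂ {v : H1 | ∃ a ∈ X, ∃ h : H1, v = a h} : Set H1) ⊆
        clspan {v : H1 | ∃ (i : M) (k : K1), v = adjoint i.1 k} := by
      refine Set.Subset.trans subset_closure (clspan_subset (clspan_closedSubspace _) ?_)
      rintro _ ⟨x, hx, h, rfl⟩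
      rw [hX] at hx
      refine clspan_map (ContinuousLinearMap.apply ℂ H1 h) (clspan_closedSubspace _) ?_ x hx
      rintro _ ⟨m, hm, n, hn, y, hy, rfl⟩
      exact subset_clspan _ ⟨⟨m, hm⟩, _, rfl⟩
    have h2 := hXd.mono this
    exact dense_closure.1 h2
  let S0 : Set ((H1 →L[ℂ] H1) × (H' →L[ℂ] H')) := {p | ∃ i j : M, ∃ y ∈ G,
    p = (adjoint i.1 ∘L (y.1 ∘L j.1), adjoint (ρ i) ∘L (y.2 ∘L ρ j))}
  let Q := (Submodule.span ℂ S0).topologicalClosure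
  have hQe : (Q : Set ((H1 →L[ℂ] H1) × (H' →L[ℂ] H'))) = clspan S0 := rfl
  have hQs : IsClosedSubspace (clspan S0) := clspan_closedSubspace _
  have hQG : ∀ x ∈ Q, ∀ i j : M,
      (i.1 ∘L (x.1 ∘L adjoint j.1), ρ i ∘L (x.2 ∘L adjoint (ρ j))) ∈ G := by
    intro x hx i j
    refine clspan_map ((sandw i.1 (adjoint j.1)).prodMap (sandw (ρ i) (adjoint (ρ j)))) hGs ?_ x hx
    rintro _ ⟨k, l, y, hy, rfl⟩
    exact (hR l j _ (hR i k _ hy).1).2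
  have hQ1 : CIle Q := Q_CIle G hMci (fun i : M => i.1) ρ hR hd2 Q
    (fun x hx i j => hGM _ (hQG x hx i j))
  have hQ2 : CIle (sw Q) := by
    refine Q_CIle (sw G) hMci' ρ (fun i : M => i.1) ?_ hd1 (sw Q) ?_
    · intro i j; rw [Mlt_sw]; exact hR i j
    · intro x hx i j; rw [Mlt_sw]; exact hGM _ (hQG _ hx i j)
  have hQiso := norm_eq_of_CI hQ1 hQ2
  let E0 : Set ((K1 →L[ℂ] K1) × (K2 →L[ℂ] K2)) := {p | ∃ i j k l : M, ∃ y ∈ G,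
    p = (i.1 ∘L adjoint j.1, ρ i ∘L adjoint (ρ j)) * y * (k.1 ∘L adjoint l.1, ρ k ∘L adjoint (ρ l))}
  have hEG : clspan E0 ⊆ G := by
    refine clspan_subset hGs ?_
    rintro _ ⟨i, j, k, l, y, hy, rfl⟩
    exact (hR k l _ (hR i j _ hy).1).2
  have hGE : ∀ b ∈ G, b ∈ clspan E0 := by
    have hE := fst_image_clspan E0 (fun p hp => hiso p (hEG hp))
    intro b hb
    have hb1 : b.1 ∈ clspan (Prod.fst '' E0) := by
      have hb1 : b.1 ∈ Y1 := (memY1 _).2 ⟨b, hb, rfl⟩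
      rw [hY] at hb1
      refine clspan_subset (clspan_closedSubspace _) ?_ hb1
      rintro _ ⟨p, hp, q, hq, x, hx, rfl⟩
      rw [hX] at hx
      refine clspan_map (sandw p (adjoint q)) (clspan_closedSubspace _) ?_ x hx
      rintro _ ⟨m, hm, n, hn, y, hy, rfl⟩
      obtain ⟨c, hc, rfl⟩ := (memY1 _).1 hy
      exact subset_clspan _ ⟨_, ⟨⟨p, hp⟩, ⟨m, hm⟩, ⟨n, hn⟩, ⟨q, hq⟩, c, hc, rfl⟩, rfl⟩
    rw [← hE] at hb1
    obtain ⟨p, hp, hpb⟩ := hb1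
    have h2 := hiso _ (G.sub_mem (hEG hp) hb)
    rw [Prod.fst_sub, hpb, sub_self, norm_zero, norm_eq_zero, Prod.snd_sub, sub_eq_zero] at h2
    have : p = b := Prod.ext hpb h2
    exact this ▸ hp
  have hX' : Prod.snd '' (Q : Set ((H1 →L[ℂ] H1) × (H' →L[ℂ] H'))) = conjTRO (Set.range ρ) Y2 := by
    rw [hQe, snd_image_clspan S0 hQiso, conjTRO]
    congr 1
    ext x
    constructor
    · rintro ⟨_, ⟨i, j, y, hy, rfl⟩, rfl⟩
      exact ⟨_, ⟨i, rfl⟩, _, ⟨j, rfl⟩, y.2, (memY2 _).2 ⟨y, hy, rfl⟩, rfl⟩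
    · rintro ⟨_, ⟨i, rfl⟩, _, ⟨j, rfl⟩, y, hy, rfl⟩
      obtain ⟨c, hc, rfl⟩ := (memY2 _).1 hy
      exact ⟨_, ⟨i, j, c, hc, rfl⟩, rfl⟩
  have hmemX' : ∀ i j : M, ∀ y ∈ G, adjoint (ρ i) ∘L (y.2 ∘L ρ j) ∈
      Prod.snd '' (Q : Set ((H1 →L[ℂ] H1) × (H' →L[ℂ] H'))) := fun i j y hy =>
    ⟨_, subset_clspan S0 ⟨i, j, y, hy, rfl⟩, rfl⟩
  refine ⟨H', i1, i2, i3, Q, Set.range ρ, _, hQ1, hQ2, ?_, ?_, rfl, hX', ?_, ?_, ?_⟩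
  · have s1 : ∀ a ∈ S0, ∀ b ∈ S0, a * b ∈ clspan S0 := by
      rintro _ ⟨i, j, y, hy, rfl⟩ _ ⟨k, l, z, hz, rfl⟩
      exact subset_clspan _ ⟨i, l, _, hmul _ (hR j k _ hy).2 _ hz, rfl⟩
    have s2 : ∀ a ∈ S0, ∀ b ∈ clspan S0, a * b ∈ clspan S0 := fun a ha =>
      clspan_map (ContinuousLinearMap.mul ℂ ((H1 →L[ℂ] H1) × (H' →L[ℂ] H')) a) hQs (s1 a ha)
    intro a ha b hb
    exact clspan_map ((ContinuousLinearMap.mul ℂ ((H1 →L[ℂ] H1) × (H' →L[ℂ] H'))).flip b) hQs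
      (fun a ha => s2 a ha b hb) a ha
  · rw [hQe, fst_image_clspan S0 hQiso, hX, conjTRO]
    congr 1
    ext x
    constructor
    · rintro ⟨_, ⟨i, j, y, hy, rfl⟩, rfl⟩
      exact ⟨_, i.2, _, j.2, y.1, (memY1 _).2 ⟨y, hy, rfl⟩, rfl⟩
    · rintro ⟨m, hm, n, hn, y, hy, rfl⟩
      obtain ⟨c, hc, rfl⟩ := (memY1 _).1 hy
      exact ⟨_, ⟨⟨m, hm⟩, ⟨n, hn⟩, c, hc, rfl⟩, rfl⟩
  · apply Set.Subset.antisymm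
    · intro y hy
      obtain ⟨c, hc, rfl⟩ := (memY2 _).1 hy
      refine clspan_map (ContinuousLinearMap.snd ℂ _ _) (clspan_closedSubspace _) ?_ c (hGE c hc)
      rintro _ ⟨i, j, k, l, y, hy, rfl⟩
      exact subset_clspan _ ⟨ρ i, ⟨i, rfl⟩, ρ l, ⟨l, rfl⟩, _, hmemX' j k y hy, rfl⟩
    · refine clspan_subset hY2s ?_
      rintro _ ⟨_, ⟨i, rfl⟩, _, ⟨j, rfl⟩, _, ⟨q, hq, rfl⟩, rfl⟩
      exact (memY2 _).2 ⟨_, hQG q hq i j, rfl⟩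
  · rintro _ ⟨i, rfl⟩ _ ⟨j, rfl⟩ y hy
    obtain ⟨c, hc, rfl⟩ := (memY2 _).1 hy
    exact ⟨(memY2 _).2 ⟨_, (hR i j c hc).1, rfl⟩, (memY2 _).2 ⟨_, (hR i j c hc).2, rfl⟩⟩
  · obtain ⟨ι, l, hl, e, heG, -, -, -, hs2, -⟩ := hau
    have hUs := clspan_closedSubspace {v : H' | ∃ a ∈ Prod.snd '' (Q : Set ((H1 →L[ℂ] H1) × (H' →L[ℂ] H'))),
      ∃ h : H', v = a h}
    have s1 : ∀ (i : M) (k : K2), ∀ y ∈ G, adjoint (ρ i) (y.2 k) ∈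
        clspan {v : H' | ∃ a ∈ Prod.snd '' (Q : Set ((H1 →L[ℂ] H1) × (H' →L[ℂ] H'))),
          ∃ h : H', v = a h} := by
      intro i k y hy
      refine clspan_map ((adjoint (ρ i)).comp ((ContinuousLinearMap.apply ℂ K2 k).comp
        (ContinuousLinearMap.snd ℂ (K1 →L[ℂ] K1) (K2 →L[ℂ] K2)))) hUs ?_ y (hGE y hy)
      rintro _ ⟨a, b, c, d, z, hz, rfl⟩
      exact subset_clspan _ ⟨_, hmemX' i c _ (hR a b z hz).1, adjoint (ρ d) k, rfl⟩
    have s2 : ∀ (i : M) (k : K2), adjoint (ρ i) k ∈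
        clspan {v : H' | ∃ a ∈ Prod.snd '' (Q : Set ((H1 →L[ℂ] H1) × (H' →L[ℂ] H'))),
          ∃ h : H', v = a h} := by
      intro i k
      refine hUs.1.mem_of_tendsto (((adjoint (ρ i)).continuous.tendsto _).comp (hs2 k))
        (Eventually.of_forall fun t => s1 i k _ (heG t))
    have s3 : (Submodule.span ℂ {v : H' | ∃ i k, v = adjoint (ρ i) k} : Set H') ⊆
        clspan {v : H' | ∃ a ∈ Prod.snd '' (Q : Set ((H1 →L[ℂ] H1) × (H' →L[ℂ] H'))),
          ∃ h : H', v = a h} := by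
      refine Set.Subset.trans subset_closure (clspan_subset hUs ?_)
      rintro _ ⟨i, k, rfl⟩
      exact s2 i k
    exact dense_closure.1 (hd2.mono s3)


theorem rep_norm {B : Set (K →L[ℂ] K)} {β : (K →L[ℂ] K) → (K1 →L[ℂ] K1)} (h : IsCIRepOn B β)
    {b : K →L[ℂ] K} (hb : b ∈ B) : ‖β b‖ = ‖b‖ := by
  have := h.2.2.2.1 1 (fun _ _ => b) (fun _ _ => hb)
  rwa [norm_matrixOp_fin1, norm_matrixOp_fin1] at this

/-- A representation as a linear map. -/
def repLin (p : Submodule ℂ (K →L[ℂ] K)) (β : (K →L[ℂ] K) → (K1 →L[ℂ] K1))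
    (h : IsCIRepOn (p : Set (K →L[ℂ] K)) β) : p →ₗ[ℂ] (K1 →L[ℂ] K1) where
  toFun b := β b
  map_add' a b := h.1 a a.2 b b.2
  map_smul' c a := h.2.1 c a a.2

/-- The graph of two representations. -/
def repGraph (p : Submodule ℂ (K →L[ℂ] K)) (β₁ : (K →L[ℂ] K) → (K1 →L[ℂ] K1))
    (β₂ : (K →L[ℂ] K) → (K2 →L[ℂ] K2))
    (h₁ : IsCIRepOn (p : Set (K →L[ℂ] K)) β₁) (h₂ : IsCIRepOn (p : Set (K →L[ℂ] K)) β₂) :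
    p →ₗᵢ[ℂ] (K1 →L[ℂ] K1) × (K2 →L[ℂ] K2) where
  toLinearMap := (repLin p β₁ h₁).prod (repLin p β₂ h₂)
  norm_map' b := by
    show ‖(β₁ b, β₂ b)‖ = ‖b‖
    rw [Prod.norm_def, rep_norm h₁ b.2, rep_norm h₂ b.2, max_self]; rfl

theorem rep_sub {p : Submodule ℂ (K →L[ℂ] K)} {β : (K →L[ℂ] K) → (K1 →L[ℂ] K1)}
    (h : IsCIRepOn (p : Set (K →L[ℂ] K)) β) {a b : K →L[ℂ] K} (ha : a ∈ p) (hb : b ∈ p) :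
    β (a - b) = β a - β b := (repLin p β h).map_sub ⟨a, ha⟩ ⟨b, hb⟩

theorem rep_tendsto {ι : Type} {l : Filter ι} [l.NeBot] {p : Submodule ℂ (K →L[ℂ] K)}
    {β : (K →L[ℂ] K) → (K1 →L[ℂ] K1)}
    (h : IsCIRepOn (p : Set (K →L[ℂ] K)) β) (hm : ∀ a ∈ p, ∀ b ∈ p, a * b ∈ p)
    (e : ι → K →L[ℂ] K) (he : ∀ t, e t ∈ p)
    (b : K →L[ℂ] K) (hb : b ∈ p) (hl : Tendsto (fun t => ‖e t * b - b‖) l (𝓝 0)) :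
    Tendsto (fun t => β (e t) * β b) l (𝓝 (β b)) := by
  rw [tendsto_iff_norm_sub_tendsto_zero]
  convert hl using 2 with t
  rw [← h.2.2.1 _ (he t) _ hb, ← rep_sub h (hm _ (he t) _ hb) hb,
    rep_norm h (p.sub_mem (hm _ (he t) _ hb) hb)]

theorem rep_strong {ι : Type} {l : Filter ι} [l.NeBot] {p : Submodule ℂ (K →L[ℂ] K)}
    {β : (K →L[ℂ] K) → (K1 →L[ℂ] K1)}
    (h : IsCIRepOn (p : Set (K →L[ℂ] K)) β) (hm : ∀ a ∈ p, ∀ b ∈ p, a * b ∈ p)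
    (e : ι → K →L[ℂ] K) (he : ∀ t, e t ∈ p) (he1 : ∀ t, ‖e t‖ ≤ 1)
    (hl : ∀ b ∈ p, Tendsto (fun t => ‖e t * b - b‖) l (𝓝 0)) (k : K1) :
    Tendsto (fun t => β (e t) k) l (𝓝 k) := by
  have hD : ∀ u ∈ Submodule.span ℂ {v : K1 | ∃ a ∈ (p : Set (K →L[ℂ] K)), ∃ h : K1, v = β a h},
      Tendsto (fun t => β (e t) u) l (𝓝 u) := by
    intro u hu
    induction hu using Submodule.span_induction with
    | mem x hx =>
      obtain ⟨a, ha, v, rfl⟩ := hx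
      have := rep_tendsto h hm e he a ha (hl a ha)
      exact ((ContinuousLinearMap.apply ℂ K1 v).continuous.tendsto _).comp this
    | zero => simp
    | add x y _ _ hx hy => simpa using hx.add hy
    | smul c x _ hx => simpa using hx.const_smul c
  obtain ⟨T, hT⟩ := exists_strong_limit (l := l) (fun t => β (e t)) 1
    (fun t => by rw [rep_norm h (he t)]; exact he1 t) _ h.2.2.2.2
    (fun u hu => ⟨u, hD u hu⟩)
  have : (T : K1 → K1) = id := Continuous.ext_on h.2.2.2.2 T.continuous continuous_id
    (fun u hu => tendsto_nhds_unique (hT u) (hD u hu))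
  have h2 := hT k
  rw [this] at h2
  exact h2

theorem trans_aux (A : Set (H →L[ℂ] H)) (B : Set (K →L[ℂ] K)) (C : Set (L →L[ℂ] L))
    (hA : IsClosedSubalgebra A)
    (hB : IsClosedSubalgebra B) (hBcai : HasCai B)
    (hAB : StronglyDeltaEquivalent A B) (hBC : StronglyDeltaEquivalent B C) :
    StronglyDeltaEquivalent A C := by
  obtain ⟨⟨hBcl, p, rfl⟩, hBm⟩ := hB
  obtain ⟨⟨hAcl, q, rfl⟩, hAm⟩ := hA
  obtain ⟨H1, K1, _, _, _, _, _, _, α₁, β₁, hα₁, hβ₁, M, hM, hX, hY⟩ := hAB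
  obtain ⟨K2, L2, _, _, _, _, _, _, β₂, γ₂, hβ₂, hγ₂, N, hN, hY2, hZ⟩ := hBC
  let G := LinearMap.range (repGraph p β₁ β₂ hβ₁ hβ₂).toLinearMap
  have hG : ∀ x, x ∈ G ↔ ∃ b ∈ p, x = (β₁ b, β₂ b) := fun x => by
    constructor
    · rintro ⟨b, rfl⟩; exact ⟨b, b.2, rfl⟩
    · rintro ⟨b, hb, rfl⟩; exact ⟨⟨b, hb⟩, rfl⟩
  have hmul : ∀ a ∈ G, ∀ b ∈ G, a * b ∈ G := by
    intro x hx y hy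
    obtain ⟨a, ha, rfl⟩ := (hG x).1 hx
    obtain ⟨b, hb, rfl⟩ := (hG y).1 hy
    refine (hG _).2 ⟨a * b, hBm _ ha _ hb, ?_⟩
    rw [hβ₁.2.2.1 _ ha _ hb, hβ₂.2.2.1 _ ha _ hb]; rfl
  have hcl : IsClosed (G : Set ((K1 →L[ℂ] K1) × (K2 →L[ℂ] K2))) := by
    haveI : CompleteSpace p := hBcl.completeSpace_coe
    have := (repGraph p β₁ β₂ hβ₁ hβ₂).isometry.isClosedEmbedding.isClosed_range
    exact this
  have hci : CIle G := by
    intro n x hx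
    choose b hb hxb using fun i j => (hG _).1 (hx i j)
    simp only [hxb]
    rw [hβ₁.2.2.2.1 n b hb, hβ₂.2.2.2.1 n b hb]
  have hci' : CIle (sw G) := by
    intro n x hx
    choose b hb hxb using fun i j => (hG (x i j).swap).1 (hx i j)
    have h1 : ∀ i j, (x i j).2 = β₁ (b i j) := fun i j => congrArg Prod.fst (hxb i j)
    have h2 : ∀ i j, (x i j).1 = β₂ (b i j) := fun i j => congrArg Prod.snd (hxb i j)
    simp only [h1, h2]
    rw [hβ₁.2.2.2.1 n b hb, hβ₂.2.2.2.1 n b hb]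
  have hau : AU G := by
    obtain ⟨ι, _, _, _, e, he, he1, hl⟩ := hBcai
    refine ⟨ι, atTop, inferInstance, fun t => (β₁ (e t), β₂ (e t)), fun t => (hG _).2 ⟨_, he t, rfl⟩,
      fun t => ?_, fun t => ?_, ?_, ?_, ?_⟩
    · show ‖β₁ (e t)‖ ≤ 1
      rw [rep_norm hβ₁ (he t)]; exact he1 t
    · show ‖β₂ (e t)‖ ≤ 1
      rw [rep_norm hβ₂ (he t)]; exact he1 t
    · exact rep_strong hβ₁ hBm e he he1 (fun b hb => (hl b hb).1)
    · exact rep_strong hβ₂ hBm e he he1 (fun b hb => (hl b hb).1)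
    · intro x hx
      obtain ⟨b, hb, rfl⟩ := (hG x).1 hx
      exact (rep_tendsto hβ₁ hBm e he b hb (hl b hb).1).prodMk_nhds
        (rep_tendsto hβ₂ hBm e he b hb (hl b hb).1)
  have hY1G : β₁ '' (p : Set (K →L[ℂ] K)) = Prod.fst '' (G : Set ((K1 →L[ℂ] K1) × (K2 →L[ℂ] K2))) := by
    ext y
    constructor
    · rintro ⟨b, hb, rfl⟩; exact ⟨_, (hG _).2 ⟨b, hb, rfl⟩, rfl⟩
    · rintro ⟨x, hx, rfl⟩
      obtain ⟨b, hb, rfl⟩ := (hG x).1 hx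
      exact ⟨b, hb, rfl⟩
  have hY2G : β₂ '' (p : Set (K →L[ℂ] K)) = Prod.snd '' (G : Set ((K1 →L[ℂ] K1) × (K2 →L[ℂ] K2))) := by
    ext y
    constructor
    · rintro ⟨b, hb, rfl⟩; exact ⟨_, (hG _).2 ⟨b, hb, rfl⟩, rfl⟩
    · rintro ⟨x, hx, rfl⟩
      obtain ⟨b, hb, rfl⟩ := (hG x).1 hx
      exact ⟨b, hb, rfl⟩
  have hXd : Nondegenerate (α₁ '' (q : Set (H →L[ℂ] H))) := by
    have := hα₁.2.2.2.2
    unfold Nondegenerate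
    convert this using 5 with v
    simp
  obtain ⟨H', _, _, _, Q, Rr, X', hQ, hQ', hQm, hQ1, hQ2, hX', hY2', hW, hX'd⟩ :=
    transfer G hmul hcl hci hci' hau M hM _ _ _ hY1G hY2G hX hY hXd
  have hex : ∀ a : H →L[ℂ] H, ∃ T : H' →L[ℂ] H', a ∈ q → (α₁ a, T) ∈ Q := by
    intro a
    by_cases ha : a ∈ q
    · have : α₁ a ∈ Prod.fst '' (Q : Set ((H1 →L[ℂ] H1) × (H' →L[ℂ] H'))) := by
        rw [hQ1]; exact ⟨a, ha, rfl⟩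
      obtain ⟨⟨x, T⟩, hx, hxa⟩ := this
      refine ⟨T, fun _ => ?_⟩
      have : x = α₁ a := hxa
      rw [← this]; exact hx
    · exact ⟨0, fun h => absurd h ha⟩
  choose α hα using hex
  have huniq : ∀ x T S, (x, T) ∈ Q → (x, S) ∈ Q → T = S := by
    intro x T S hT hS
    have := norm_eq_of_CI hQ hQ' _ (Q.sub_mem hT hS)
    simp only [Prod.mk_sub_mk, sub_self, norm_zero] at this
    exact sub_eq_zero.1 (norm_eq_zero.1 this)
  have himg : α '' (q : Set (H →L[ℂ] H)) = X' := by
    rw [← hQ2]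
    ext T
    constructor
    · rintro ⟨a, ha, rfl⟩; exact ⟨_, hα a ha, rfl⟩
    · rintro ⟨⟨x, T⟩, hx, rfl⟩
      have : x ∈ α₁ '' (q : Set (H →L[ℂ] H)) := by rw [← hQ1]; exact ⟨_, hx, rfl⟩
      obtain ⟨a, ha, rfl⟩ := this
      exact ⟨a, ha, huniq _ _ _ (hα a ha) hx⟩
  refine ⟨H', L2, inferInstance, inferInstance, inferInstance, inferInstance, inferInstance,
    inferInstance, α, γ₂, ⟨?_, ?_, ?_, ?_, ?_⟩, hγ₂, ?_⟩
  · intro a ha b hb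
    apply huniq (α₁ (a + b)) _ _ (hα _ (q.add_mem ha hb))
    rw [hα₁.1 a ha b hb]
    exact Q.add_mem (hα a ha) (hα b hb)
  · intro c a ha
    apply huniq (α₁ (c • a)) _ _ (hα _ (q.smul_mem c ha))
    rw [hα₁.2.1 c a ha]
    exact Q.smul_mem c (hα a ha)
  · intro a ha b hb
    apply huniq (α₁ (a * b)) _ _ (hα _ (hAm _ ha _ hb))
    rw [hα₁.2.2.1 a ha b hb]
    exact hQm _ (hα a ha) _ (hα b hb)
  · intro n x hx
    rw [← hα₁.2.2.2.1 n x hx]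
    exact le_antisymm (hQ n (fun i j => (α₁ (x i j), α (x i j))) (fun i j => hα _ (hx i j)))
      (hQ' n (fun i j => (α (x i j), α₁ (x i j))) (fun i j => hα _ (hx i j)))
  · have := hX'd
    rw [← himg] at this
    unfold Nondegenerate at this
    convert this using 5 with v
    simp
  · rw [himg]
    exact TRO_comp Rr N hN X' _ _ hX' hY2' hY2 hZ hW

end aux

/-- Strong Δ-equivalence is transitive for nondegenerately acting operator
algebras with contractive approximate identities. -/
theorem strongDeltaEquivalence_trans
    (A : Set (H →L[ℂ] H)) (B : Set (K →L[ℂ] K)) (C : Set (L →L[ℂ] L))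
    (hA : IsClosedSubalgebra A) (hB : IsClosedSubalgebra B) (hC : IsClosedSubalgebra C)
    (hAnd : Nondegenerate A) (hBnd : Nondegenerate B) (hCnd : Nondegenerate C)
    (hAcai : HasCai A) (hBcai : HasCai B) (hCcai : HasCai C)
    (hAB : StronglyDeltaEquivalent A B) (hBC : StronglyDeltaEquivalent B C) :
    StronglyDeltaEquivalent A C := by
  exact trans_aux A B C hA hB hBcai hAB hBC
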